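/- Let k be a field of characteristic zero containing all ℓ-power roots of unity for some integer ℓ ≥ 2, and let n, N ≥ 1. Let S be the monoid of k-algebra endomorphisms of k(x_1,…,x_n) of the form x_j ↦ λ_j·x_j^{q_j} for 1 ≤ j ≤ n, with λ_j ∈ k^× and q_j ∈ ℤ∖{0} (so S ≅ (ℤ_{≠0} ⋉ k^×)^n). Then the natural map H^1(S, GL_N(k)) → H^1(S, GL_N(k(x_1,…,x_n))) is bijective: every 1-cocycle of S with values in GL_N(k(x_1,…,x_n)) is cohomologous, via some g ∈ GL_N(k(x_1,…,x_n)), to a 1-cocycle with constant values in GL_N(k) (a monoid homomorphism S → GL_N(k)); and two monoid homomorphisms S → GL_N(k) that are cohomologous via an element of GL_N(k(x_1,…,x_n)) are conjugate by an element of GL_N(k). -/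

import Mathlib

namespace TorusCocycle

open MvPolynomial

noncomputable section

variable {k : Type} [Field k] {n N : ℕ}

/-- Scaling of the variables. -/
def scal (a : Fin n → kˣ) : MvPolynomial (Fin n) k →ₐ[k] MvPolynomial (Fin n) k :=
  aeval (fun j => C (a j : k) * X j)

/-- The character of the torus attached to a monomial. -/
def chi (a : Fin n → kˣ) (α : Fin n →₀ ℕ) : k := ∏ j, (a j : k) ^ (α j)

theorem scal_X (a : Fin n → kˣ) (j : Fin n) : scal a (X j) = C (a j : k) * X j := by
  simp [scal]

theorem scal_monomial (a : Fin n → kˣ) (α : Fin n →₀ ℕ) (c : k) :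
    scal a (monomial α c) = monomial α (chi a α * c) := by
  rw [scal, aeval_monomial, Finsupp.prod_fintype _ _ (by simp)]
  simp only [mul_pow, Finset.prod_mul_distrib, chi]
  rw [monomial_eq (s := α), Finsupp.prod_fintype _ _ (by simp), algebraMap_eq]
  simp only [map_mul, map_prod, map_pow]
  ring

theorem coeff_scal (a : Fin n → kˣ) (α : Fin n →₀ ℕ) (p : MvPolynomial (Fin n) k) :
    coeff α (scal a p) = chi a α * coeff α p := by
  classical
  induction p using MvPolynomial.induction_on' with
  | monomial u c =>
    rw [scal_monomial, coeff_monomial, coeff_monomial]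
    split_ifs with h
    · rw [h]
    · simp
  | add p q hp hq => rw [map_add, coeff_add, coeff_add, hp, hq, mul_add]

theorem chi_mul (a b : Fin n → kˣ) (α : Fin n →₀ ℕ) : chi (a * b) α = chi a α * chi b α := by
  simp [chi, mul_pow, Finset.prod_mul_distrib]

theorem chi_one (α : Fin n →₀ ℕ) : chi (1 : Fin n → kˣ) α = 1 := by
  simp [chi]

theorem chi_ne_zero (a : Fin n → kˣ) (α : Fin n →₀ ℕ) : chi a α ≠ 0 := by
  simp [chi, Finset.prod_ne_zero_iff]

theorem scal_mul (a b : Fin n → kˣ) (p : MvPolynomial (Fin n) k) :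
    scal (a * b) p = scal a (scal b p) := by
  ext α
  simp only [coeff_scal, chi_mul, mul_assoc]

theorem scal_one (p : MvPolynomial (Fin n) k) :
    scal 1 p = p := by
  ext α
  simp only [coeff_scal, chi_one, one_mul]

theorem scal_inv_scal (a : Fin n → kˣ) (p : MvPolynomial (Fin n) k) :
    scal a⁻¹ (scal a p) = p := by
  rw [← scal_mul, inv_mul_cancel, scal_one]

theorem scal_scal_inv (a : Fin n → kˣ) (p : MvPolynomial (Fin n) k) :
    scal a (scal a⁻¹ p) = p := by
  rw [← scal_mul, mul_inv_cancel, scal_one]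

theorem scal_injective (a : Fin n → kˣ) :
    Function.Injective (scal a : MvPolynomial (Fin n) k → MvPolynomial (Fin n) k) :=
  Function.LeftInverse.injective (scal_inv_scal a)

/-- Scaling as an equivalence. -/
def scalE (a : Fin n → kˣ) : MvPolynomial (Fin n) k ≃ₐ[k] MvPolynomial (Fin n) k :=
  AlgEquiv.ofAlgHom (scal a) (scal a⁻¹) (by ext1 j; exact scal_scal_inv a _)
    (by ext1 j; exact scal_inv_scal a _)

theorem scal_prime (a : Fin n → kˣ) {p : MvPolynomial (Fin n) k} (hp : Prime p) :
    Prime (scal a p) :=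
  (MulEquiv.prime_iff (scalE a).toMulEquiv).2 hp

theorem support_scal (a : Fin n → kˣ) (p : MvPolynomial (Fin n) k) :
    (scal a p).support = p.support := by
  ext α
  simp [coeff_scal, chi_ne_zero]

theorem totalDegree_scal (a : Fin n → kˣ) (p : MvPolynomial (Fin n) k) :
    (scal a p).totalDegree = p.totalDegree := by
  simp only [totalDegree, support_scal]

/-- polynomials embedded in rational functions -/
abbrev emb : MvPolynomial (Fin n) k →ₐ[k] FractionRing (MvPolynomial (Fin n) k) :=
  IsScalarTower.toAlgHom k (MvPolynomial (Fin n) k) (FractionRing (MvPolynomial (Fin n) k))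

theorem emb_injective : Function.Injective
    (emb : MvPolynomial (Fin n) k →ₐ[k] FractionRing (MvPolynomial (Fin n) k)) :=
  IsFractionRing.injective _ _

theorem emb_eq (p : MvPolynomial (Fin n) k) : emb p = algebraMap (MvPolynomial (Fin n) k)
    (FractionRing (MvPolynomial (Fin n) k)) p := rfl

theorem emb_ne_zero {p : MvPolynomial (Fin n) k} (hp : p ≠ 0) :
    (emb p : FractionRing (MvPolynomial (Fin n) k)) ≠ 0 :=
  fun h => hp (emb_injective (by rw [h, map_zero]))

/-- torus elements -/
def tors (a : Fin n → kˣ) :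
    FractionRing (MvPolynomial (Fin n) k) →ₐ[k] FractionRing (MvPolynomial (Fin n) k) :=
  IsFractionRing.liftAlgHom (g := emb.comp (scal a))
    (fun _ _ h => scal_injective a (emb_injective h))

theorem tors_emb (a : Fin n → kˣ) (p : MvPolynomial (Fin n) k) :
    tors a (emb p) = emb (scal a p) := by
  exact IsFractionRing.lift_algebraMap (K := FractionRing (MvPolynomial (Fin n) k))
    (g := ((emb.comp (scal a) : MvPolynomial (Fin n) k →ₐ[k] FractionRing (MvPolynomial (Fin n) k)) :
      MvPolynomial (Fin n) k →+* FractionRing (MvPolynomial (Fin n) k)))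
    (fun _ _ h => scal_injective a (emb_injective h)) p

/-- power maps -/
def frob (q : ℕ) (hq : 0 < q) :
    FractionRing (MvPolynomial (Fin n) k) →ₐ[k] FractionRing (MvPolynomial (Fin n) k) :=
  IsFractionRing.liftAlgHom (g := emb.comp (expand q))
    (fun _ _ h => expand_injective hq (emb_injective h))

theorem frob_emb (q : ℕ) (hq : 0 < q) (p : MvPolynomial (Fin n) k) :
    frob q hq (emb p) = emb (expand q p) := by
  exact IsFractionRing.lift_algebraMap (K := FractionRing (MvPolynomial (Fin n) k))
    (g := ((emb.comp (expand q) : MvPolynomial (Fin n) k →ₐ[k] FractionRing (MvPolynomial (Fin n) k)) :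
      MvPolynomial (Fin n) k →+* FractionRing (MvPolynomial (Fin n) k)))
    (fun _ _ h => expand_injective hq (emb_injective h)) p

theorem hom_ext {s t : FractionRing (MvPolynomial (Fin n) k) →ₐ[k] FractionRing (MvPolynomial (Fin n) k)}
    (h : ∀ j, s (emb (X j)) = t (emb (X j))) : s = t := by
  have h1 : s.comp emb = t.comp emb := by
    apply MvPolynomial.algHom_ext
    exact h
  apply AlgHom.coe_ringHom_injective
  apply IsLocalization.ringHom_ext (nonZeroDivisors (MvPolynomial (Fin n) k))
  exact RingHom.ext fun x => DFunLike.congr_fun h1 x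

theorem exists_frac (u : FractionRing (MvPolynomial (Fin n) k)) :
    ∃ p q : MvPolynomial (Fin n) k, q ≠ 0 ∧ emb q * u = emb p := by
  obtain ⟨p, q, hq, rfl⟩ := IsFractionRing.div_surjective (A := MvPolynomial (Fin n) k) u
  refine ⟨p, q, nonZeroDivisors.ne_zero hq, ?_⟩
  have : emb q ≠ (0 : FractionRing (MvPolynomial (Fin n) k)) :=
    emb_ne_zero (nonZeroDivisors.ne_zero hq)
  simp only [emb_eq] at *
  field_simp

theorem tors_X (a : Fin n → kˣ) (j : Fin n) :
    tors a (emb (X j)) = algebraMap k _ (a j : k) * emb (X j) := by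
  rw [tors_emb, scal_X, map_mul]
  congr 1

theorem frob_X (q : ℕ) (hq : 0 < q) (j : Fin n) :
    (frob q hq (emb (X j)) : FractionRing (MvPolynomial (Fin n) k)) = emb (X j) ^ q := by
  rw [frob_emb, expand_X, map_pow]

theorem tors_mul (a b : Fin n → kˣ) : tors a * tors b = tors (a * b) := by
  apply hom_ext
  intro j
  rw [AlgHom.mul_apply, tors_X, map_mul, tors_X, tors_X, AlgHom.commutes]
  simp only [Pi.mul_apply, Units.val_mul, map_mul]
  ring

theorem tors_one : tors (1 : Fin n → kˣ) = 1 := by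
  apply hom_ext
  intro j
  rw [tors_X]
  simp

theorem tors_pow (a : Fin n → kˣ) (i : ℕ) : tors a ^ i = tors (a ^ i) := by
  induction i with
  | zero => rw [pow_zero, pow_zero, tors_one]
  | succ i ih => rw [pow_succ, ih, tors_mul, pow_succ]

theorem tors_frob (a : Fin n → kˣ) (q : ℕ) (hq : 0 < q) :
    tors a * frob q hq = frob q hq * tors (a ^ q) := by
  apply hom_ext
  intro j
  rw [AlgHom.mul_apply, AlgHom.mul_apply, tors_X, map_mul, frob_X, map_pow, tors_X, AlgHom.commutes]
  simp only [Pi.pow_apply, Units.val_pow_eq_pow_val, map_pow]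
  ring

theorem frob_mul (q r : ℕ) (hq : 0 < q) (hr : 0 < r) :
    (frob q hq * frob r hr : FractionRing (MvPolynomial (Fin n) k) →ₐ[k] _) =
      frob (q * r) (Nat.mul_pos hq hr) := by
  apply hom_ext
  intro j
  rw [AlgHom.mul_apply, frob_X, map_pow, frob_X, frob_X, pow_mul]

/-- eigenvector property of monomials -/
theorem tors_monomial (a : Fin n → kˣ) (α : Fin n →₀ ℕ) :
    tors a (emb (monomial α (1 : k))) = algebraMap k _ (chi a α) * emb (monomial α 1) := by
  rw [tors_emb, scal_monomial, ← C_mul_monomial, map_mul]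
  congr 1

end

end TorusCocycle

namespace TorusCocycle

open MvPolynomial

noncomputable section

variable {k : Type} [Field k] {n N : ℕ}

/-- bounded complexity of a matrix of rational functions -/
def Cplx (B : Matrix (Fin N) (Fin N) (FractionRing (MvPolynomial (Fin n) k))) (D : ℕ) : Prop :=
  ∃ Q : MvPolynomial (Fin n) k, Q ≠ 0 ∧ Q.totalDegree ≤ D ∧
    ∃ P : Fin N → Fin N → MvPolynomial (Fin n) k,
      (∀ i j, (P i j).totalDegree ≤ D) ∧ ∀ i j, emb Q * B i j = emb (P i j)

theorem exists_den (B : Matrix (Fin N) (Fin N) (FractionRing (MvPolynomial (Fin n) k))) :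
    ∃ Q : MvPolynomial (Fin n) k, Q ≠ 0 ∧ ∃ P : Fin N → Fin N → MvPolynomial (Fin n) k,
      ∀ i j, emb Q * B i j = emb (P i j) := by
  classical
  choose p q hq h using fun i j => exists_frac (B i j)
  refine ⟨∏ x : Fin N × Fin N, q x.1 x.2, Finset.prod_ne_zero_iff.2 fun x _ => hq _ _,
    fun i j => (∏ x ∈ Finset.univ.erase (i, j), q x.1 x.2) * p i j, fun i j => ?_⟩
  rw [← Finset.prod_erase_mul Finset.univ _ (Finset.mem_univ (i, j)), map_mul, map_mul, mul_assoc,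
    h]

theorem cplx_exists (B : Matrix (Fin N) (Fin N) (FractionRing (MvPolynomial (Fin n) k))) :
    ∃ D, Cplx B D := by
  classical
  obtain ⟨Q, hQ, P, hP⟩ := exists_den B
  refine ⟨Q.totalDegree + ∑ x : Fin N × Fin N, (P x.1 x.2).totalDegree, Q, hQ, by omega, P,
    fun i j => ?_, hP⟩
  have := Finset.single_le_sum (f := fun x : Fin N × Fin N => (P x.1 x.2).totalDegree)
    (fun _ _ => Nat.zero_le _) (Finset.mem_univ (i, j))
  simp only at this
  omega

theorem Cplx.mono {B : Matrix (Fin N) (Fin N) (FractionRing (MvPolynomial (Fin n) k))} {D E : ℕ}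
    (h : Cplx B D) (hDE : D ≤ E) : Cplx B E := by
  obtain ⟨Q, hQ, hd, P, hP, hPd⟩ := h
  exact ⟨Q, hQ, hd.trans hDE, P, fun i j => (hP i j).trans hDE, hPd⟩

theorem Cplx.mul {B B' : Matrix (Fin N) (Fin N) (FractionRing (MvPolynomial (Fin n) k))} {D D' : ℕ}
    (h : Cplx B D) (h' : Cplx B' D') : Cplx (B * B') (D + D') := by
  obtain ⟨Q, hQ, hd, P, hPd, hP⟩ := h
  obtain ⟨Q', hQ', hd', P', hPd', hP'⟩ := h'
  refine ⟨Q * Q', mul_ne_zero hQ hQ', (totalDegree_mul _ _).trans (by omega),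
    fun i j => ∑ l, P i l * P' l j, fun i j => ?_, fun i j => ?_⟩
  · apply totalDegree_finsetSum_le
    intro l _
    have := totalDegree_mul (P i l) (P' l j)
    have := hPd i l
    have := hPd' l j
    omega
  · rw [Matrix.mul_apply, Finset.mul_sum, map_sum]
    refine Finset.sum_congr rfl fun l _ => ?_
    rw [map_mul, map_mul, ← hP, ← hP']
    ring

theorem Cplx.tors {B : Matrix (Fin N) (Fin N) (FractionRing (MvPolynomial (Fin n) k))} {D : ℕ}
    (h : Cplx B D) (a : Fin n → kˣ) : Cplx (B.map (tors a)) D := by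
  obtain ⟨Q, hQ, hd, P, hPd, hP⟩ := h
  refine ⟨scal a Q, fun h => hQ (scal_injective a (by rw [h, map_zero])),
    by rwa [totalDegree_scal], fun i j => scal a (P i j), fun i j => ?_, fun i j => ?_⟩
  · rw [totalDegree_scal]; exact hPd i j
  · rw [Matrix.map_apply, ← tors_emb, ← tors_emb, ← map_mul, hP]

/-- residue component -/
def compo (q : ℕ) (r : Fin n → ℕ) : MvPolynomial (Fin n) k →ₗ[k] MvPolynomial (Fin n) k :=
  (basisMonomials (Fin n) k).constr k (fun α => if ∀ j, α j % q = r j then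
    monomial (Finsupp.equivFunOnFinite.symm fun j => α j / q) 1 else 0)

theorem compo_monomial (q : ℕ) (r : Fin n → ℕ) (α : Fin n →₀ ℕ) (c : k) :
    compo q r (monomial α c) = if ∀ j, α j % q = r j then
    monomial (Finsupp.equivFunOnFinite.symm fun j => α j / q) c else 0 := by
  have h1 : compo q r (monomial α (1 : k)) = if ∀ j, α j % q = r j then
    monomial (Finsupp.equivFunOnFinite.symm fun j => α j / q) 1 else 0 := by
    have := (basisMonomials (Fin n) k).constr_basis k (fun α => if ∀ j, α j % q = r j then
      monomial (Finsupp.equivFunOnFinite.symm fun j => α j / q) (1 : k) else 0) α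
    rw [coe_basisMonomials] at this
    exact this
  have h2 : monomial α c = c • monomial α (1 : k) := by rw [smul_monomial, smul_eq_mul, mul_one]
  rw [h2, map_smul, h1]
  split_ifs
  · rw [smul_monomial, smul_eq_mul, mul_one]
  · rw [smul_zero]

theorem coeff_compo (q : ℕ) (hq : 0 < q) (r : Fin n → ℕ) (hr : ∀ j, r j < q) (β : Fin n →₀ ℕ)
    (P : MvPolynomial (Fin n) k) :
    coeff β (compo q r P) = coeff (Finsupp.equivFunOnFinite.symm fun j => q * β j + r j) P := by
  classical
  induction P using MvPolynomial.induction_on' with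
  | monomial u c =>
    rw [compo_monomial, coeff_monomial]
    by_cases h : u = Finsupp.equivFunOnFinite.symm fun j => q * β j + r j
    · rw [if_pos h, if_pos, coeff_monomial, if_pos]
      · ext j; subst h
        simp [Nat.mul_add_div hq, Nat.div_eq_of_lt (hr j)]
      · intro j; subst h
        simp [Nat.mod_eq_of_lt (hr j)]
    · rw [if_neg h]
      split_ifs with h1
      · rw [coeff_monomial, if_neg]
        intro h2
        apply h
        ext j
        have : u j / q = β j := by rw [← h2]; rfl
        have h3 := Nat.div_add_mod (u j) q
        rw [h1 j, this] at h3
        simp [h3]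
      · simp
  | add p q hp hq => rw [map_add, coeff_add, coeff_add, hp, hq]

theorem compo_mul_expand (q : ℕ) (hq : 0 < q) (r : Fin n → ℕ)
    (P A : MvPolynomial (Fin n) k) :
    compo q r (P * expand q A) = compo q r P * A := by
  classical
  induction P using MvPolynomial.induction_on' with
  | monomial u c =>
    induction A using MvPolynomial.induction_on' with
    | monomial v d =>
      rw [expand_monomial, monomial_mul, compo_monomial, compo_monomial]
      have : ∀ j, (u + q • v) j % q = u j % q := by intro j; simp
      simp only [this]
      split_ifs with h
      · rw [monomial_mul]
        congr 2
        ext j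
        simp [Nat.add_mul_div_left _ _ hq]
      · simp
    | add p q hp hq => rw [map_add, mul_add, mul_add, map_add, hp, hq]
  | add p q hp hq => rw [add_mul, map_add, map_add, hp, hq, add_mul]

theorem totalDegree_compo (q : ℕ) (hq : 0 < q) (r : Fin n → ℕ) (hr : ∀ j, r j < q)
    (P : MvPolynomial (Fin n) k) : (compo q r P).totalDegree ≤ P.totalDegree / q := by
  rw [totalDegree_eq, Finset.sup_le_iff]
  intro β hβ
  rw [mem_support_iff, coeff_compo q hq r hr] at hβ
  have := le_totalDegree (mem_support_iff.2 hβ)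
  rw [Nat.le_div_iff_mul_le hq, Finsupp.card_toMultiset]
  refine le_trans ?_ this
  rw [Finsupp.sum_fintype _ _ (by simp), Finsupp.sum_fintype _ _ (by simp), Finset.sum_mul]
  apply Finset.sum_le_sum
  intro j _
  simp [mul_comm]

theorem Cplx.of_frob {B : Matrix (Fin N) (Fin N) (FractionRing (MvPolynomial (Fin n) k))} {D : ℕ}
    (q : ℕ) (hq : 0 < q) (h : Cplx (B.map (frob q hq)) D) : Cplx B (D / q) := by
  obtain ⟨Q, hQ, hd, P, hPd, hP⟩ := h
  obtain ⟨α, hα⟩ := ne_zero_iff.1 hQ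
  have hr : ∀ j, α j % q < q := fun j => Nat.mod_lt _ hq
  refine ⟨compo q (fun j => α j % q) Q, ?_, ?_, fun i j => compo q (fun j => α j % q) (P i j),
    fun i j => ?_, fun i j => ?_⟩
  · rw [ne_zero_iff]
    refine ⟨Finsupp.equivFunOnFinite.symm fun j => α j / q, ?_⟩
    rw [coeff_compo q hq _ hr]
    convert hα using 2
    ext j
    simp [Nat.div_add_mod]
  · exact (totalDegree_compo q hq _ hr _).trans (Nat.div_le_div_right hd)
  · exact (totalDegree_compo q hq _ hr _).trans (Nat.div_le_div_right (hPd i j))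
  · obtain ⟨u, w, hw, huw⟩ := exists_frac (B i j)
    have h1 := hP i j
    rw [Matrix.map_apply] at h1
    have h2 : Q * expand q u = P i j * expand q w := by
      apply emb_injective
      rw [map_mul, map_mul, ← frob_emb q hq, ← huw, map_mul, ← h1, frob_emb]
      ring
    have h3 := congrArg (compo q (fun j => α j % q)) h2
    rw [compo_mul_expand q hq, compo_mul_expand q hq] at h3
    have h4 := congrArg (fun x => (emb x : FractionRing (MvPolynomial (Fin n) k))) h3
    simp only [map_mul] at h4
    rw [← huw] at h4
    apply mul_right_cancel₀ (emb_ne_zero hw)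
    rw [← h4]
    ring

theorem bounded_cplx (a : Fin n → kˣ)
    (b : ℕ → Matrix (Fin N) (Fin N) (FractionRing (MvPolynomial (Fin n) k)))
    (hb : ∀ i j, b (i + j) = b i * (b j).map (tors (a ^ i)))
    (F F' : Matrix (Fin N) (Fin N) (FractionRing (MvPolynomial (Fin n) k)))
    (hF : ∀ j, (b (2 * j)).map (frob 2 two_pos) = F' * b j * F.map (tors (a ^ j))) :
    ∃ D, ∀ j, Cplx (b j) D := by
  obtain ⟨c0, h0⟩ := cplx_exists (b 0)
  obtain ⟨c1, h1⟩ := cplx_exists (b 1)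
  obtain ⟨C, hC⟩ := cplx_exists F
  obtain ⟨C', hC'⟩ := cplx_exists F'
  refine ⟨2 * (c0 + c1) + (C + C'), fun j => ?_⟩
  induction j using Nat.strong_induction_on with
  | _ j ih =>
    rcases Nat.eq_zero_or_pos j with rfl | hj
    · exact h0.mono (by omega)
    · have key : Cplx (b (2 * (j / 2))) ((C' + (2 * (c0 + c1) + (C + C')) + C) / 2) := by
        apply Cplx.of_frob 2 two_pos
        rw [hF]
        exact (hC'.mul (ih _ (by omega))).mul (hC.tors _)
      rcases Nat.mod_two_eq_zero_or_one j with h | h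
      · rw [show j = 2 * (j / 2) by omega]
        exact key.mono (by omega)
      · rw [show j = 1 + 2 * (j / 2) by omega, hb]
        exact (h1.mul (key.tors _)).mono (by omega)

end

end TorusCocycle

namespace TorusCocycle

open MvPolynomial

noncomputable section

variable {k : Type} [Field k] {n N : ℕ}

/-- product of the variables -/
def mon : MvPolynomial (Fin n) k := ∏ j, X j

/-- genericity of a torus element -/
def Generic (a : Fin n → kˣ) : Prop :=
  ∀ s : ℕ, 0 < s → ∀ α β : Fin n →₀ ℕ, chi a α ^ s = chi a β ^ s → α = β

theorem chi_pow (a : Fin n → kˣ) (s : ℕ) (α : Fin n →₀ ℕ) : chi (a ^ s) α = chi a α ^ s := by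
  induction s with
  | zero => rw [pow_zero, pow_zero, chi_one]
  | succ s ih => rw [pow_succ, pow_succ, chi_mul, ih]

theorem chi_inv (a : Fin n → kˣ) (α : Fin n →₀ ℕ) : chi a⁻¹ α = (chi a α)⁻¹ := by
  have h := chi_mul a⁻¹ a α
  rw [inv_mul_cancel, chi_one] at h
  exact eq_inv_of_mul_eq_one_left h.symm

theorem chi_zpow (a : Fin n → kˣ) (s : ℤ) (α : Fin n →₀ ℕ) : chi (a ^ s) α = chi a α ^ s := by
  cases s with
  | ofNat s => simp [chi_pow]
  | negSucc s => rw [zpow_negSucc, zpow_negSucc, chi_inv, chi_pow]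

theorem Generic.zpow_inj {a : Fin n → kˣ} (ha : Generic a) {t : ℤ} (ht : t ≠ 0)
    {α β : Fin n →₀ ℕ} (h : chi a α ^ t = chi a β ^ t) : α = β := by
  rcases Int.natAbs_eq t with h1 | h1
  · rw [h1, zpow_natCast, zpow_natCast] at h
    exact ha _ (by omega) _ _ h
  · rw [h1, zpow_neg, zpow_neg, zpow_natCast, zpow_natCast, inv_inj] at h
    exact ha _ (by omega) _ _ h

theorem monomial_dvd_mon {p : MvPolynomial (Fin n) k} (hp : Prime p) (α : Fin n →₀ ℕ) (c : k)
    (hpc : p = monomial α c) : p ∣ mon := by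
  have hc : c ≠ 0 := by
    rintro rfl
    exact hp.ne_zero (by rw [hpc, monomial_zero])
  have h1 : p ∣ ∏ j, (mon : MvPolynomial (Fin n) k) ^ α j := by
    have : p ∣ ∏ j, (X j : MvPolynomial (Fin n) k) ^ α j := by
      refine ⟨C c⁻¹, ?_⟩
      rw [hpc, monomial_eq, Finsupp.prod_fintype _ _ (by simp), mul_comm, ← mul_assoc, ← C_mul,
        inv_mul_cancel₀ hc, C_1, one_mul]
    refine this.trans (Finset.prod_dvd_prod_of_dvd _ _ fun j _ => pow_dvd_pow_of_dvd ?_ _)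
    exact Finset.dvd_prod_of_mem _ (Finset.mem_univ j)
  obtain ⟨j, _, hj⟩ := hp.exists_mem_finset_dvd h1
  exact hp.dvd_of_dvd_pow hj

theorem stab {a : Fin n → kˣ} (ha : Generic a) {p : MvPolynomial (Fin n) k} (hp : Prime p)
    (hm : ¬ p ∣ mon) (t : ℤ) (h : Associated (scal (a ^ t) p) p) : t = 0 := by
  by_contra ht
  apply hm
  obtain ⟨u, hu⟩ := h
  obtain ⟨r, hr, hur⟩ := isUnit_iff_eq_C_of_isReduced.1 u.isUnit
  rw [hur, mul_comm] at hu
  have hco : ∀ α, r * (chi a α ^ t * coeff α p) = coeff α p := by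
    intro α
    rw [← chi_zpow, ← coeff_scal, ← coeff_C_mul, hu]
  obtain ⟨α, hα⟩ := ne_zero_iff.1 hp.ne_zero
  refine monomial_dvd_mon hp α (coeff α p) ?_
  classical
  ext β
  rw [coeff_monomial]
  split_ifs with hαβ
  · rw [hαβ]
  · by_contra hβ
    apply hαβ
    apply ha.zpow_inj ht
    have h1 := hco α
    have h2 := hco β
    have e1 : r * chi a α ^ t = 1 := by
      apply mul_right_cancel₀ hα; rw [one_mul, mul_assoc, h1]
    have e2 : r * chi a β ^ t = 1 := by
      apply mul_right_cancel₀ hβ; rw [one_mul, mul_assoc, h2]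
    exact mul_left_cancel₀ hr.ne_zero (e1.trans e2.symm)

theorem scal_dvd_iff (a : Fin n → kˣ) (p q : MvPolynomial (Fin n) k) :
    scal a p ∣ scal a q ↔ p ∣ q := by
  constructor
  · intro h
    have := map_dvd (scal a⁻¹) h
    rwa [scal_inv_scal, scal_inv_scal] at this
  · exact map_dvd (scal a)

theorem scal_zpow_add (a : Fin n → kˣ) (s t : ℤ) (p : MvPolynomial (Fin n) k) :
    scal (a ^ s) (scal (a ^ t) p) = scal (a ^ (s + t)) p := by
  rw [zpow_add, scal_mul]

theorem scal_assoc (a : Fin n → kˣ) {p q : MvPolynomial (Fin n) k} (h : Associated p q) :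
    Associated (scal a p) (scal a q) := h.map (scal a)

theorem scal_mon (a : Fin n → kˣ) : Associated (scal a (mon : MvPolynomial (Fin n) k)) mon := by
  rw [mon, map_prod]
  simp only [scal_X]
  rw [Finset.prod_mul_distrib]
  apply associated_unit_mul_left
  rw [← map_prod]
  refine IsUnit.map C (isUnit_iff_ne_zero.2 ?_)
  simp [Finset.prod_ne_zero_iff]

theorem scal_dvd_mon (a : Fin n → kˣ) (p : MvPolynomial (Fin n) k) :
    scal a p ∣ mon ↔ p ∣ mon := by
  rw [← (scal_mon a).dvd_iff_dvd_right, scal_dvd_iff]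

theorem bad_finite {a : Fin n → kˣ} (ha : Generic a) {d : MvPolynomial (Fin n) k} (hd : d ≠ 0) :
    {t : ℤ | ∃ p, Prime p ∧ ¬ p ∣ mon ∧ p ∣ d ∧ p ∣ scal (a ^ t) d}.Finite := by
  classical
  let Fs := (UniqueFactorizationMonoid.factors d).toFinset
  have hsub : {t : ℤ | ∃ p, Prime p ∧ ¬ p ∣ mon ∧ p ∣ d ∧ p ∣ scal (a ^ t) d} ⊆
      ⋃ x ∈ (↑(Fs ×ˢ Fs) : Set (MvPolynomial (Fin n) k × MvPolynomial (Fin n) k)),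
        {t : ℤ | Prime x.1 ∧ ¬ x.1 ∣ mon ∧ Associated (scal (a ^ t) x.2) x.1} := by
    rintro t ⟨p, hp, hpm, hpd, hpt⟩
    obtain ⟨p1, hp1, hpp1⟩ := UniqueFactorizationMonoid.exists_mem_factors_of_dvd hd
      hp.irreducible hpd
    have hp' : Prime (scal (a ^ (-t)) p) := scal_prime _ hp
    have hp'd : scal (a ^ (-t)) p ∣ d := by
      rw [← scal_dvd_iff (a ^ t), scal_zpow_add]
      simpa [scal_one] using hpt
    obtain ⟨p2, hp2, hpp2⟩ := UniqueFactorizationMonoid.exists_mem_factors_of_dvd hd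
      hp'.irreducible hp'd
    simp only [Set.mem_iUnion]
    refine ⟨(p1, p2), by simp [Fs, hp1, hp2], hpp1.prime hp, ?_, ?_⟩
    · rwa [← hpp1.dvd_iff_dvd_left]
    · refine Associated.trans (scal_assoc _ hpp2.symm) ?_
      rw [scal_zpow_add]
      simpa [scal_one] using hpp1
  refine Set.Finite.subset (Set.Finite.biUnion (Finset.finite_toSet _) ?_) hsub
  rintro ⟨p1, p2⟩ _
  apply Set.Subsingleton.finite
  rintro t ⟨h1, h2, h3⟩ t' ⟨_, _, h3'⟩
  have h4 : Associated (scal (a ^ (t' - t)) p1) p1 := by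
    refine Associated.trans (scal_assoc _ h3.symm) ?_
    rw [scal_zpow_add]
    simpa using h3'
  have := stab ha h1 h2 _ h4
  omega

theorem exists_window {a : Fin n → kˣ} (ha : Generic a) {d : MvPolynomial (Fin n) k} (hd : d ≠ 0) :
    ∃ c : ℕ, ∀ p : MvPolynomial (Fin n) k, Prime p → ¬ p ∣ mon → ∀ i i' : ℤ,
      p ∣ scal (a ^ i) d → p ∣ scal (a ^ i') d → |i' - i| < c := by
  obtain ⟨c, hc⟩ : ∃ c : ℕ, ∀ t ∈ {t : ℤ | ∃ p, Prime p ∧ ¬ p ∣ mon ∧ p ∣ d ∧ p ∣ scal (a ^ t) d},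
      |t| < c := by
    obtain ⟨M, hM⟩ := ((bad_finite ha hd).image (fun t => |t|)).bddAbove
    refine ⟨M.toNat + 1, fun t ht => ?_⟩
    have := hM ⟨t, ht, rfl⟩
    simp only at this
    omega
  refine ⟨c, fun p hp hpm i i' h h' => hc _ ⟨scal (a ^ (-i)) p, scal_prime _ hp, ?_, ?_, ?_⟩⟩
  · rwa [scal_dvd_mon]
  · rw [← scal_dvd_iff (a ^ i), scal_zpow_add]
    simpa [scal_one] using h
  · rw [← scal_dvd_iff (a ^ i), scal_zpow_add, scal_zpow_add]
    simpa [scal_one] using h'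

/-- integrality at a prime -/
def IntAt (p : MvPolynomial (Fin n) k)
    (B : Matrix (Fin N) (Fin N) (FractionRing (MvPolynomial (Fin n) k))) : Prop :=
  ∃ Q : MvPolynomial (Fin n) k, ¬ p ∣ Q ∧ ∃ P : Fin N → Fin N → MvPolynomial (Fin n) k,
    ∀ i j, emb Q * B i j = emb (P i j)

theorem IntAt.mul {p : MvPolynomial (Fin n) k} (hp : Prime p)
    {B B' : Matrix (Fin N) (Fin N) (FractionRing (MvPolynomial (Fin n) k))}
    (h : IntAt p B) (h' : IntAt p B') : IntAt p (B * B') := by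
  obtain ⟨Q, hQ, P, hP⟩ := h
  obtain ⟨Q', hQ', P', hP'⟩ := h'
  refine ⟨Q * Q', fun h => (hp.dvd_or_dvd h).elim hQ hQ', fun i j => ∑ l, P i l * P' l j,
    fun i j => ?_⟩
  rw [Matrix.mul_apply, Finset.mul_sum, map_sum]
  refine Finset.sum_congr rfl fun l _ => ?_
  rw [map_mul, map_mul, ← hP, ← hP']
  ring

theorem IntAt.one {p : MvPolynomial (Fin n) k} (hp : Prime p) :
    IntAt p (1 : Matrix (Fin N) (Fin N) (FractionRing (MvPolynomial (Fin n) k))) := by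
  refine ⟨1, hp.not_dvd_one, fun i j => if i = j then 1 else 0, fun i j => ?_⟩
  rw [Matrix.one_apply]
  split_ifs with h <;> simp [h]

theorem IntAt.tors {p : MvPolynomial (Fin n) k}
    {B : Matrix (Fin N) (Fin N) (FractionRing (MvPolynomial (Fin n) k))}
    (h : IntAt p B) (a : Fin n → kˣ) : IntAt (scal a p) (B.map (tors a)) := by
  obtain ⟨Q, hQ, P, hP⟩ := h
  refine ⟨scal a Q, by rwa [scal_dvd_iff], fun i j => scal a (P i j), fun i j => ?_⟩
  rw [Matrix.map_apply, ← tors_emb, ← tors_emb, ← map_mul, hP]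

theorem map_tors_map (a b : Fin n → kˣ)
    (B : Matrix (Fin N) (Fin N) (FractionRing (MvPolynomial (Fin n) k))) :
    (B.map (tors b)).map (tors a) = B.map (tors (a * b)) := by
  rw [Matrix.map_map, ← tors_mul]
  rfl

theorem map_mul_tors (a : Fin n → kˣ)
    (B B' : Matrix (Fin N) (Fin N) (FractionRing (MvPolynomial (Fin n) k))) :
    (B * B').map (tors a) = B.map (tors a) * B'.map (tors a) :=
  Matrix.map_mul (f := (tors a).toRingHom)

theorem map_one_tors (a : Fin n → kˣ) :
    (1 : Matrix (Fin N) (Fin N) (FractionRing (MvPolynomial (Fin n) k))).map (tors a) = 1 := by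
  apply Matrix.map_one <;> simp

theorem intAt_tors_iff {p : MvPolynomial (Fin n) k}
    {B : Matrix (Fin N) (Fin N) (FractionRing (MvPolynomial (Fin n) k))}
    (a : Fin n → kˣ) : IntAt (scal a p) (B.map (tors a)) ↔ IntAt p B := by
  refine ⟨fun h => ?_, fun h => h.tors a⟩
  have := h.tors a⁻¹
  rw [scal_inv_scal, map_tors_map, inv_mul_cancel, tors_one] at this
  convert this using 1
  ext i j
  rfl

theorem card_le_degree {ι : Type} (s : Finset ι) (p : ι → MvPolynomial (Fin n) k)
    (hp : ∀ i ∈ s, Prime (p i)) (hne : ∀ i ∈ s, ∀ j ∈ s, i ≠ j → ¬ Associated (p i) (p j)) :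
    ∀ Q : MvPolynomial (Fin n) k, Q ≠ 0 → (∀ i ∈ s, p i ∣ Q) → s.card ≤ Q.totalDegree := by
  classical
  induction s using Finset.induction_on with
  | empty => simp
  | insert i s hi ih =>
    intro Q hQ hdvd
    obtain ⟨Q1, rfl⟩ := hdvd i (Finset.mem_insert_self i s)
    have hpi := hp i (Finset.mem_insert_self i s)
    have hQ1 : Q1 ≠ 0 := right_ne_zero_of_mul hQ
    have h1 := ih (fun j hj => hp j (Finset.mem_insert_of_mem hj))
      (fun j hj l hl => hne j (Finset.mem_insert_of_mem hj) l (Finset.mem_insert_of_mem hl))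
      Q1 hQ1 (fun j hj => by
        have hpj := hp j (Finset.mem_insert_of_mem hj)
        refine (hpj.dvd_or_dvd (hdvd j (Finset.mem_insert_of_mem hj))).resolve_left fun h => ?_
        exact hne j (Finset.mem_insert_of_mem hj) i (Finset.mem_insert_self i s)
          (fun h => hi (h ▸ hj)) (hpj.associated_of_dvd hpi h))
    rw [Finset.card_insert_of_notMem hi, totalDegree_mul_of_isDomain hpi.ne_zero hQ1]
    have h2 : (p i).totalDegree ≠ 0 := by
      intro h
      rw [totalDegree_eq_zero_iff_eq_C] at h
      apply hpi.not_isUnit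
      rw [h]
      refine IsUnit.map C (isUnit_iff_ne_zero.2 fun h0 => hpi.ne_zero ?_)
      rw [h, h0, C_0]
    omega

theorem dvd_pow_degree (X : MvPolynomial (Fin n) k) (Q : MvPolynomial (Fin n) k) :
    Q ≠ 0 → (∀ p, Prime p → p ∣ Q → p ∣ X) → Q ∣ X ^ Q.totalDegree := by
  induction Q using UniqueFactorizationMonoid.induction_on_prime with
  | h₁ => intro h; exact absurd rfl h
  | h₂ x hx => intro _ _; exact hx.dvd
  | h₃ Q p hQ hp ih =>
    intro _ h
    have h1 := ih hQ fun p' hp' h' => h p' hp' (h'.mul_left _)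
    have h2 := h p hp (dvd_mul_right _ _)
    have h3 : 1 ≤ p.totalDegree := card_le_degree {()} (fun _ => p) (by simpa using hp) (by simp)
      p hp.ne_zero (by simp)
    rw [totalDegree_mul_of_isDomain hp.ne_zero hQ, pow_add]
    exact mul_dvd_mul (h2.trans (dvd_pow_self _ (by omega))) h1

theorem exists_min_den {B : Matrix (Fin N) (Fin N) (FractionRing (MvPolynomial (Fin n) k))} {D : ℕ}
    (h : Cplx B D) : ∃ Q : MvPolynomial (Fin n) k, Q ≠ 0 ∧ Q.totalDegree ≤ D ∧
    (∃ P : Fin N → Fin N → MvPolynomial (Fin n) k,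
      (∀ i j, (P i j).totalDegree ≤ D) ∧ ∀ i j, emb Q * B i j = emb (P i j)) ∧
    ∀ p, Prime p → p ∣ Q → ¬ IntAt p B := by
  obtain ⟨Q, hQ, hd, hex⟩ := h
  induction hm : Q.totalDegree using Nat.strong_induction_on generalizing Q with
  | _ m ih =>
    by_cases hall : ∀ p, Prime p → p ∣ Q → ¬ IntAt p B
    · exact ⟨Q, hQ, hd, hex, hall⟩
    push Not at hall
    obtain ⟨p, hp, ⟨Q1, rfl⟩, Q', hQ', P', hP'⟩ := hall
    obtain ⟨P, hPd, hP⟩ := hex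
    have hQ1 : Q1 ≠ 0 := right_ne_zero_of_mul hQ
    have h3 : 1 ≤ p.totalDegree := card_le_degree {()} (fun _ => p) (by simpa using hp) (by simp)
      p hp.ne_zero (by simp)
    rw [totalDegree_mul_of_isDomain hp.ne_zero hQ1] at hm hd
    have h4 : ∀ i j, ∃ P1, P i j = p * P1 := by
      intro i j
      have : Q' * P i j = p * (Q1 * P' i j) := by
        apply emb_injective
        simp only [map_mul, ← hP, ← hP']
        ring
      exact (hp.dvd_or_dvd (Dvd.intro _ this.symm)).resolve_left hQ'
    choose P1 hP1 using h4
    refine ih _ (by omega) Q1 hQ1 (by omega) ⟨P1, fun i j => ?_, fun i j => ?_⟩ rfl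
    · by_cases h0 : P1 i j = 0
      · rw [h0]; simp
      · have := hPd i j
        rw [hP1, totalDegree_mul_of_isDomain hp.ne_zero h0] at this
        omega
    · have := hP i j
      rw [hP1, map_mul, map_mul, mul_assoc] at this
      exact mul_left_cancel₀ (emb_ne_zero hp.ne_zero) this

end

end TorusCocycle

namespace TorusCocycle

open MvPolynomial

noncomputable section

variable {k : Type} [Field k] {n N : ℕ}

/-- a cocycle on the natural numbers together with its inverse -/
structure Coc (a : Fin n → kˣ)
    (b bi : ℕ → Matrix (Fin N) (Fin N) (FractionRing (MvPolynomial (Fin n) k))) : Prop where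
  zero : b 0 = 1
  izero : bi 0 = 1
  add : ∀ i j, b (i + j) = b i * (b j).map (tors (a ^ i))
  iadd : ∀ i j, bi (i + j) = (bi j).map (tors (a ^ i)) * bi i
  mul_inv : ∀ i, b i * bi i = 1
  inv_mul : ∀ i, bi i * b i = 1

theorem fact1 {a : Fin n → kˣ}
    {b bi : ℕ → Matrix (Fin N) (Fin N) (FractionRing (MvPolynomial (Fin n) k))}
    (hc : Coc a b bi) {d : MvPolynomial (Fin n) k}
    {P P' : Fin N → Fin N → MvPolynomial (Fin n) k}
    (hP : ∀ i j, emb d * b 1 i j = emb (P i j)) (hP' : ∀ i j, emb d * bi 1 i j = emb (P' i j))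
    {p : MvPolynomial (Fin n) k} (hp : Prime p) (s : ℕ) (j : ℕ)
    (h : ∀ i < j, ¬ p ∣ scal (a ^ (s + i)) d) :
    IntAt p ((b j).map (tors (a ^ s))) ∧ IntAt p ((bi j).map (tors (a ^ s))) := by
  induction j with
  | zero => 
    rw [hc.zero, hc.izero, map_one_tors]
    exact ⟨IntAt.one hp, IntAt.one hp⟩
  | succ j ih =>
    obtain ⟨h1, h2⟩ := ih fun i hi => h i (by omega)
    have h3 := h j (by omega)
    rw [hc.add, hc.iadd, map_mul_tors, map_mul_tors, map_tors_map, map_tors_map, ← pow_add]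
    refine ⟨h1.mul hp ⟨_, h3, fun r t => scal (a ^ (s + j)) (P r t), fun r t => ?_⟩,
      IntAt.mul hp ⟨_, h3, fun r t => scal (a ^ (s + j)) (P' r t), fun r t => ?_⟩ h2⟩
    · rw [Matrix.map_apply, ← tors_emb, ← tors_emb, ← map_mul, hP]
    · rw [Matrix.map_apply, ← tors_emb, ← tors_emb, ← map_mul, hP']

theorem map_tors_pow_zero (a : Fin n → kˣ)
    (B : Matrix (Fin N) (Fin N) (FractionRing (MvPolynomial (Fin n) k))) :
    B.map (tors (a ^ 0)) = B := by
  rw [pow_zero, tors_one]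
  ext i j
  rfl

theorem fact2 {a : Fin n → kˣ}
    {b bi : ℕ → Matrix (Fin N) (Fin N) (FractionRing (MvPolynomial (Fin n) k))}
    (hc : Coc a b bi) {d : MvPolynomial (Fin n) k}
    {P P' : Fin N → Fin N → MvPolynomial (Fin n) k}
    (hP : ∀ i j, emb d * b 1 i j = emb (P i j)) (hP' : ∀ i j, emb d * bi 1 i j = emb (P' i j))
    {c : ℕ} (hwin : ∀ p : MvPolynomial (Fin n) k, Prime p → ¬ p ∣ mon → ∀ i i' : ℤ,
      p ∣ scal (a ^ i) d → p ∣ scal (a ^ i') d → |i' - i| < c)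
    {p : MvPolynomial (Fin n) k} (hp : Prime p) (hpm : ¬ p ∣ mon) (i j : ℕ) (hci : c ≤ i)
    (hij : i + c ≤ j) (hd : p ∣ scal (a ^ i) d) :
    IntAt p (b j) ↔ IntAt p ((b (2 * c)).map (tors (a ^ (i - c)))) := by
  have hno : ∀ i' : ℕ, (i' + c ≤ i ∨ i + c ≤ i') → ¬ p ∣ scal (a ^ i') d := by
    intro i' hi' hdv
    have := hwin p hp hpm (i : ℤ) (i' : ℤ) (by rwa [zpow_natCast]) (by rwa [zpow_natCast])
    rw [abs_lt] at this
    omega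
  obtain ⟨h1, h1'⟩ := fact1 hc hP hP' hp 0 (i - c) (fun t ht => hno _ (by omega))
  obtain ⟨h2, h2'⟩ := fact1 hc hP hP' hp (i + c) (j - (i + c)) (fun t ht => hno _ (by omega))
  rw [map_tors_pow_zero] at h1 h1'
  have e : b j = b (i - c) * (b (2 * c)).map (tors (a ^ (i - c))) *
      (b (j - (i + c))).map (tors (a ^ (i + c))) := by
    rw [← hc.add, show i - c + 2 * c = i + c by omega, ← hc.add]
    congr 1
    omega
  constructor
  · intro h
    have e2 : (b (2 * c)).map (tors (a ^ (i - c))) = bi (i - c) * b j *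
        (bi (j - (i + c))).map (tors (a ^ (i + c))) := by
      have h3 : (b (j - (i + c))).map (tors (a ^ (i + c))) *
        (bi (j - (i + c))).map (tors (a ^ (i + c))) = 1 := by
        rw [← map_mul_tors, hc.mul_inv, map_one_tors]
      rw [e]
      simp only [Matrix.mul_assoc]
      rw [h3, Matrix.mul_one, ← Matrix.mul_assoc, hc.inv_mul, Matrix.one_mul]
    rw [e2]
    exact (h1'.mul hp h).mul hp h2'
  · intro h
    rw [e]
    exact (h1.mul hp h).mul hp h2

theorem fact3 {a : Fin n → kˣ} (ha : Generic a)
    {b bi : ℕ → Matrix (Fin N) (Fin N) (FractionRing (MvPolynomial (Fin n) k))}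
    (hc : Coc a b bi) {d : MvPolynomial (Fin n) k}
    {P P' : Fin N → Fin N → MvPolynomial (Fin n) k}
    (hP : ∀ i j, emb d * b 1 i j = emb (P i j)) (hP' : ∀ i j, emb d * bi 1 i j = emb (P' i j))
    {c : ℕ} (hwin : ∀ p : MvPolynomial (Fin n) k, Prime p → ¬ p ∣ mon → ∀ i i' : ℤ,
      p ∣ scal (a ^ i) d → p ∣ scal (a ^ i') d → |i' - i| < c)
    {D : ℕ} {j : ℕ} (hD : Cplx (b j) D) (hj : D + 2 * c ≤ j)
    {p : MvPolynomial (Fin n) k} (hp : Prime p) (hpm : ¬ p ∣ mon) (hni : ¬ IntAt p (b j)) :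
    ∃ i < j, (i < c ∨ j < i + c) ∧ p ∣ scal (a ^ i) d := by
  by_contra! hcon
  obtain ⟨i, hij, hi⟩ : ∃ i < j, p ∣ scal (a ^ i) d := by
    by_contra! h
    apply hni
    have := (fact1 hc hP hP' hp 0 j (by simpa using h)).1
    rwa [map_tors_pow_zero] at this
  have hi1 : c ≤ i := by
    by_contra h; exact hcon i hij (Or.inl (by omega)) hi
  have hi2 : i + c ≤ j := by
    by_contra h; exact hcon i hij (Or.inr (by omega)) hi
  obtain ⟨Q, hQ, hQd, R, -, hR⟩ := hD
  rw [fact2 hc hP hP' hwin hp hpm i j hi1 hi2 hi] at hni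
  have hzn : ∀ m : ℕ, a ^ (m : ℤ) = a ^ m := fun m => zpow_natCast a m
  have := card_le_degree (Finset.Icc c (j - c)) (fun i' : ℕ => scal (a ^ ((i' : ℤ) - i)) p)
    (fun i' _ => scal_prime _ hp) ?_ Q hQ ?_
  · rw [Nat.card_Icc] at this
    omega
  · intro i1 _ i2 _ hne has
    have h2 := scal_assoc (a ^ ((i : ℤ) - i2)) has
    rw [scal_zpow_add, scal_zpow_add] at h2
    have h3 : scal (a ^ ((i : ℤ) - i2 + (i2 - i))) p = p := by
      rw [show (i : ℤ) - i2 + (i2 - i) = 0 by ring, zpow_zero, scal_one]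
    rw [h3] at h2
    have := stab ha hp hpm _ h2
    omega
  · intro i' hi'
    rw [Finset.mem_Icc] at hi'
    by_contra hnd
    apply hni
    have hp' := scal_prime (a ^ ((i' : ℤ) - i)) hp
    have h1 : IntAt (scal (a ^ ((i' : ℤ) - i)) p) (b j) := ⟨Q, hnd, R, hR⟩
    rw [fact2 hc hP hP' hwin hp' (by rwa [scal_dvd_mon]) i' j (by omega) (by omega)] at h1
    · rw [← intAt_tors_iff (a ^ ((i' : ℤ) - i)), map_tors_map]
      convert h1 using 4
      rw [← hzn, ← hzn, ← zpow_add]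
      congr 1
      omega
    · rw [← hzn, show (i' : ℤ) = (i' - i) + i by ring, ← scal_zpow_add, add_sub_cancel_right,
        scal_dvd_iff, hzn]
      exact hi

theorem scal_ne_zero (a : Fin n → kˣ) {p : MvPolynomial (Fin n) k} (hp : p ≠ 0) :
    scal a p ≠ 0 := fun h => hp (scal_injective a (by rw [h, map_zero]))

theorem mon_ne_zero : (mon : MvPolynomial (Fin n) k) ≠ 0 :=
  Finset.prod_ne_zero_iff.2 fun j _ => X_ne_zero j

theorem fact5 {a : Fin n → kˣ} (ha : Generic a)
    {b bi : ℕ → Matrix (Fin N) (Fin N) (FractionRing (MvPolynomial (Fin n) k))}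
    (hc : Coc a b bi) {D : ℕ} (hD : ∀ j, Cplx (b j) D) :
    ∃ h A : MvPolynomial (Fin n) k, h ≠ 0 ∧ A ≠ 0 ∧ ∃ D' J : ℕ, ∀ j ≥ J, ∀ r s,
      ∃ P : MvPolynomial (Fin n) k, P.totalDegree ≤ D' ∧
        emb A * (b j r s * emb (scal (a ^ j) h)) = emb P := by
  obtain ⟨d1, hd1, P1, hP1⟩ := exists_den (b 1)
  obtain ⟨d2, hd2, P2, hP2⟩ := exists_den (bi 1)
  obtain ⟨d, hd, P, P', hP, hP'⟩ : ∃ d : MvPolynomial (Fin n) k, d ≠ 0 ∧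
      ∃ P P' : Fin N → Fin N → MvPolynomial (Fin n) k,
      (∀ i j, emb d * b 1 i j = emb (P i j)) ∧ (∀ i j, emb d * bi 1 i j = emb (P' i j)) := by
    refine ⟨d1 * d2, mul_ne_zero hd1 hd2, fun i j => d2 * P1 i j, fun i j => d1 * P2 i j,
      fun i j => ?_, fun i j => ?_⟩
    · rw [map_mul, map_mul, ← hP1]; ring
    · rw [map_mul, map_mul, ← hP2]; ring
  obtain ⟨c, hwin⟩ := exists_window ha hd
  set A : MvPolynomial (Fin n) k := ∏ i ∈ Finset.range c, scal (a ^ i) d with hA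
  set A' : MvPolynomial (Fin n) k := ∏ i ∈ Finset.range c, scal (a⁻¹ ^ (i + 1)) d with hA'
  have hA0 : A ≠ 0 := Finset.prod_ne_zero_iff.2 fun i _ => scal_ne_zero _ hd
  have hA'0 : A' ≠ 0 := Finset.prod_ne_zero_iff.2 fun i _ => scal_ne_zero _ hd
  refine ⟨A' ^ D, (mon * A) ^ D, pow_ne_zero _ hA'0, pow_ne_zero _ (mul_ne_zero mon_ne_zero hA0),
    ((mon * A) ^ D).totalDegree + (A' ^ D).totalDegree + D, D + 2 * c, fun j hj r s => ?_⟩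
  obtain ⟨Q, hQ, hQd, ⟨R, hRd, hR⟩, hQp⟩ := exists_min_den (hD j)
  have hX : Q ∣ (mon * A * scal (a ^ j) A') ^ Q.totalDegree := by
    refine dvd_pow_degree _ Q hQ fun p hp hpQ => ?_
    by_cases hpm : p ∣ mon
    · exact (hpm.mul_right _).mul_right _
    obtain ⟨i, hij, hi, hpi⟩ := fact3 ha hc hP hP' hwin (hD j) hj hp hpm (hQp p hp hpQ)
    rcases hi with hi | hi
    · refine Dvd.dvd.mul_right (Dvd.dvd.mul_left (hpi.trans ?_) _) _
      exact Finset.dvd_prod_of_mem (fun i => scal (a ^ i) d) (Finset.mem_range.2 hi)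
    · refine Dvd.dvd.mul_left (hpi.trans ?_) _
      rw [hA', map_prod]
      refine dvd_trans ?_ (Finset.dvd_prod_of_mem _ (Finset.mem_range.2
        (show j - i - 1 < c by omega)))
      rw [← scal_mul, show j - i - 1 + 1 = j - i by omega]
      have : a ^ j * a⁻¹ ^ (j - i) = a ^ i := by
        rw [inv_pow, mul_inv_eq_iff_eq_mul, ← pow_add]
        congr 1; omega
      rw [this]
  obtain ⟨Y, hY⟩ := hX.trans (pow_dvd_pow _ hQd)
  rw [mul_pow, ← map_pow] at hY
  have h0 : (mon * A) ^ D * scal (a ^ j) (A' ^ D) ≠ 0 :=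
    mul_ne_zero (pow_ne_zero _ (mul_ne_zero mon_ne_zero hA0))
      (scal_ne_zero _ (pow_ne_zero _ hA'0))
  have hY0 : Y ≠ 0 := by
    rintro rfl
    rw [mul_zero] at hY
    exact h0 hY
  refine ⟨Y * R r s, ?_, ?_⟩
  · have e1 := congrArg totalDegree hY
    rw [totalDegree_mul_of_isDomain hQ hY0] at e1
    have e2 := totalDegree_mul ((mon * A) ^ D) (scal (a ^ j) (A' ^ D))
    rw [totalDegree_scal] at e2
    have e3 := totalDegree_mul Y (R r s)
    have e4 := hRd r s
    omega
  · rw [map_mul, ← hR]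
    calc _ = emb ((mon * A) ^ D * scal (a ^ j) (A' ^ D)) * b j r s := by rw [map_mul]; ring
      _ = _ := by rw [hY, map_mul]; ring

end

end TorusCocycle

namespace TorusCocycle

open MvPolynomial

noncomputable section

variable {k : Type} [Field k] {n N : ℕ}

/-- rational functions -/
abbrev RF (k : Type) [Field k] (n : ℕ) := FractionRing (MvPolynomial (Fin n) k)

/-- abstract system of semilinear operators -/
structure Sys (a : Fin n → kˣ) (T : Module.End k (Fin N → RF k n))
    (sg : ℕ → Module.End k (Fin N → RF k n)) : Prop where
  T_smul : ∀ (y : RF k n) (v : Fin N → RF k n), T (y • v) = tors a y • T v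
  T_inj : Function.Injective T
  sg_comm : ∀ q, 0 < q → ∀ v, T (sg q v) = sg q ((T ^ q) v)
  sg_inj : ∀ q, 0 < q → Function.Injective (sg q)
  sg_li : ∀ q, 0 < q → ∀ u : Fin N → (Fin N → RF k n), LinearIndependent (RF k n) u →
    LinearIndependent (RF k n) (fun i => sg q (u i))

section general

variable {V : Type} [AddCommGroup V] [Module k V]

theorem exists_annih (T : Module.End k V) (u : V) (J : ℕ) (F : Submodule k V) [Module.Finite k F]
    (h : ∀ j ≥ J, (T ^ j) u ∈ F) : ∃ p : Polynomial k, p ≠ 0 ∧ Polynomial.aeval T p u = 0 := by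
  let φ : Polynomial k →ₗ[k] V :=
    (LinearMap.applyₗ u).comp ((Polynomial.aeval T).toLinearMap.comp
      (LinearMap.mulRight k (Polynomial.X ^ J : Polynomial k)))
  have hφ : ∀ p, φ p = Polynomial.aeval T (p * Polynomial.X ^ J) u := fun p => rfl
  have hF : ∀ p, φ p ∈ F := by
    intro p
    induction p using Polynomial.induction_on' with
    | add p q hp hq => rw [map_add]; exact F.add_mem hp hq
    | monomial m c =>
      rw [hφ, Polynomial.monomial_mul_X_pow, Polynomial.aeval_monomial]
      rw [Module.End.mul_apply, Module.algebraMap_end_apply]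
      exact F.smul_mem _ (h _ (by omega))
  by_contra! hcon
  have hinj : Function.Injective (φ.codRestrict F hF) := by
    rw [← LinearMap.ker_eq_bot, LinearMap.ker_eq_bot']
    intro p hp
    by_contra hp0
    refine hcon (p * Polynomial.X ^ J) (mul_ne_zero hp0 (pow_ne_zero _ Polynomial.X_ne_zero)) ?_
    rw [← hφ]
    exact congrArg Subtype.val hp
  have := Module.Finite.of_injective _ hinj
  exact Polynomial.not_finite this

theorem coprime_indep {ι : Type} (T : Module.End k V) (s : Finset ι) (p : ι → Polynomial k)
    (v : ι → V) (hp : ∀ i ∈ s, ∀ j ∈ s, i ≠ j → IsCoprime (p i) (p j))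
    (hv : ∀ i ∈ s, Polynomial.aeval T (p i) (v i) = 0) (hsum : ∑ i ∈ s, v i = 0) :
    ∀ i ∈ s, v i = 0 := by
  classical
  intro i hi
  have hco : IsCoprime (p i) (∏ j ∈ s.erase i, p j) :=
    IsCoprime.prod_right fun j hj => hp i hi j (Finset.mem_of_mem_erase hj)
      (Finset.ne_of_mem_erase hj).symm
  have h1 : Polynomial.aeval T (∏ j ∈ s.erase i, p j) (v i) = 0 := by
    have h2 := congrArg (Polynomial.aeval T (∏ j ∈ s.erase i, p j)) hsum
    rw [map_sum, map_zero, ← Finset.add_sum_erase _ _ hi, Finset.sum_eq_zero (s := s.erase i),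
      add_zero] at h2
    · exact h2
    · intro l hl
      rw [← Finset.prod_erase_mul _ _ hl, map_mul, Module.End.mul_apply,
        hv l (Finset.mem_of_mem_erase hl), map_zero]
  obtain ⟨x, y, hxy⟩ := hco
  have h3 := congrArg (fun q => Polynomial.aeval T q (v i)) hxy
  simp only [map_add, map_mul, map_one, LinearMap.add_apply, Module.End.mul_apply, h1, hv i hi,
    map_zero, add_zero, Module.End.one_apply] at h3
  exact h3.symm

theorem ker_prod_le {ι : Type} (T : Module.End k V) (s : Finset ι) (p : ι → Polynomial k)
    (hp : ∀ i ∈ s, ∀ j ∈ s, i ≠ j → IsCoprime (p i) (p j)) (F : Submodule k V)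
    (hF : ∀ i ∈ s, LinearMap.ker (Polynomial.aeval T (p i)) ≤ F) :
    LinearMap.ker (Polynomial.aeval T (∏ i ∈ s, p i)) ≤ F := by
  classical
  induction s using Finset.induction_on with
  | empty =>
    rw [Finset.prod_empty, map_one]
    intro v hv
    have : v = 0 := hv
    rw [this]; exact F.zero_mem
  | insert i s hi ih =>
    rw [Finset.prod_insert hi, ← Polynomial.sup_ker_aeval_eq_ker_aeval_mul_of_coprime]
    · exact sup_le (hF i (Finset.mem_insert_self i s)) (ih
        (fun j hj l hl => hp j (Finset.mem_insert_of_mem hj) l (Finset.mem_insert_of_mem hl))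
        (fun j hj => hF j (Finset.mem_insert_of_mem hj)))
    · exact IsCoprime.prod_right fun j hj => hp i (Finset.mem_insert_self i s) j
        (Finset.mem_insert_of_mem hj) (fun h => hi (h ▸ hj))

theorem aeval_dvd (T : Module.End k V) {p q : Polynomial k} (h : p ∣ q) {v : V}
    (hv : Polynomial.aeval T p v = 0) : Polynomial.aeval T q v = 0 := by
  obtain ⟨r, rfl⟩ := h
  rw [mul_comm, map_mul, Module.End.mul_apply, hv, map_zero]

theorem exists_min_annih (T : Module.End k V) (u : V)
    (h : ∃ p : Polynomial k, p ≠ 0 ∧ Polynomial.aeval T p u = 0) :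
    ∃ p : Polynomial k, p ≠ 0 ∧ Polynomial.aeval T p u = 0 ∧
      ∀ q : Polynomial k, q ≠ 0 → Polynomial.aeval T q u = 0 → p.natDegree ≤ q.natDegree := by
  classical
  have h1 : ∃ m, ∃ p : Polynomial k, p ≠ 0 ∧ Polynomial.aeval T p u = 0 ∧ p.natDegree = m := by
    obtain ⟨p, hp, hp'⟩ := h
    exact ⟨_, p, hp, hp', rfl⟩
  obtain ⟨p, hp, hpu, hpd⟩ := Nat.find_spec h1
  exact ⟨p, hp, hpu, fun q hq hqu => hpd ▸ Nat.find_min' h1 ⟨q, hq, hqu, rfl⟩⟩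

theorem exists_eigen (T : Module.End k V) (u : V) (p : Polynomial k) (hp : p ≠ 0)
    (hpu : Polynomial.aeval T p u = 0)
    (hmin : ∀ q : Polynomial k, q ≠ 0 → Polynomial.aeval T q u = 0 → p.natDegree ≤ q.natDegree)
    (c : AlgebraicClosure k) (hc : Polynomial.aeval c p = 0) :
    ∃ v : V, v ≠ 0 ∧ Polynomial.aeval T (minpoly k c) v = 0 := by
  obtain ⟨p', rfl⟩ := minpoly.dvd k c hc
  have hi : IsIntegral k c := Algebra.IsIntegral.isIntegral c
  have hp' : p' ≠ 0 := right_ne_zero_of_mul hp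
  refine ⟨Polynomial.aeval T p' u, fun h0 => ?_, ?_⟩
  · have := hmin p' hp' h0
    rw [Polynomial.natDegree_mul (minpoly.ne_zero hi) hp'] at this
    have := minpoly.natDegree_pos hi
    omega
  · rw [← Module.End.mul_apply, ← map_mul]
    exact hpu

theorem dvd_pow_of_roots (P : Polynomial (AlgebraicClosure k)) (hP : P ≠ 0)
    (G : Polynomial (AlgebraicClosure k)) (h : ∀ c, P.IsRoot c → G.IsRoot c) :
    P ∣ G ^ P.natDegree := by
  have hs := IsAlgClosed.splits P
  have h1 := hs.eq_prod_roots
  have h2 : ∀ ms : Multiset (AlgebraicClosure k), (∀ c ∈ ms, G.IsRoot c) →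
      (ms.map (fun c => Polynomial.X - Polynomial.C c)).prod ∣ G ^ ms.card := by
    intro ms
    induction ms using Multiset.induction_on with
    | empty => intro _; simp
    | cons c ms ih =>
      intro h
      rw [Multiset.map_cons, Multiset.prod_cons, Multiset.card_cons, pow_succ, mul_comm]
      exact mul_dvd_mul (ih fun c' hc' => h c' (Multiset.mem_cons_of_mem hc'))
        (Polynomial.dvd_iff_isRoot.2 (h c (Multiset.mem_cons_self _ _)))
  have h3 := h2 P.roots fun c hc => h c (Polynomial.isRoot_of_mem_roots hc)
  rw [← hs.natDegree_eq_card_roots] at h3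
  refine dvd_trans ?_ h3
  have hu : IsUnit (Polynomial.C P.leadingCoeff) :=
    Polynomial.isUnit_C.2 (isUnit_iff_ne_zero.2 (Polynomial.leadingCoeff_ne_zero.2 hP))
  conv_lhs => rw [h1]
  exact (hu.mul_left_dvd).2 dvd_rfl

end general

theorem minpoly_coprime (c c' : AlgebraicClosure k) (h : minpoly k c ≠ minpoly k c') :
    IsCoprime (minpoly k c) (minpoly k c') := by
  have hi : IsIntegral k c := Algebra.IsIntegral.isIntegral c
  have hi' : IsIntegral k c' := Algebra.IsIntegral.isIntegral c'
  rw [(minpoly.irreducible hi).coprime_iff_not_dvd]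
  intro hd
  exact h (Polynomial.eq_of_monic_of_associated (minpoly.monic hi) (minpoly.monic hi')
    ((minpoly.irreducible hi).associated_of_dvd (minpoly.irreducible hi') hd))

section sys

variable {a : Fin n → kˣ} {T : Module.End k (Fin N → RF k n)}
    {sg : ℕ → Module.End k (Fin N → RF k n)}

theorem Sys.aeval_smul (H : Sys a T sg) {γ : k} {y : RF k n} (hy : tors a y = γ • y)
    (r : Polynomial k) (v : Fin N → RF k n) : Polynomial.aeval T r (y • v) =
      y • Polynomial.aeval T (r.comp (Polynomial.C γ * Polynomial.X)) v := by
  induction r using Polynomial.induction_on' with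
  | add p q hp hq =>
    rw [map_add, LinearMap.add_apply, hp, hq, Polynomial.add_comp, map_add, LinearMap.add_apply,
      smul_add]
  | monomial m c =>
    have h1 : ∀ m : ℕ, (T ^ m) (y • v) = y • (γ ^ m • (T ^ m) v) := by
      intro m
      induction m with
      | zero => simp
      | succ m ih =>
        rw [pow_succ', Module.End.mul_apply, ih, H.T_smul, hy, map_smul, Module.End.mul_apply,
          pow_succ, smul_assoc, smul_comm γ y, smul_smul γ, mul_comm]
    rw [Polynomial.aeval_monomial, Polynomial.monomial_comp, mul_pow, ← Polynomial.C_pow,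
      Module.End.mul_apply, h1, Module.algebraMap_end_apply]
    simp only [map_mul, Polynomial.aeval_C, Polynomial.aeval_X, map_pow, Module.End.mul_apply]
    rw [← map_pow, Module.algebraMap_end_apply, Module.algebraMap_end_apply, smul_comm]

theorem Sys.aeval_sg (H : Sys a T sg) (q : ℕ) (hq : 0 < q)
    (r : Polynomial k) (v : Fin N → RF k n) : Polynomial.aeval T r (sg q v) =
      sg q (Polynomial.aeval T (Polynomial.expand k q r) v) := by
  induction r using Polynomial.induction_on' with
  | add p q hp hq =>
    rw [map_add, LinearMap.add_apply, hp, hq, map_add, map_add, LinearMap.add_apply, map_add]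
  | monomial m c =>
    have h1 : ∀ m : ℕ, (T ^ m) (sg q v) = sg q ((T ^ (m * q)) v) := by
      intro m
      induction m with
      | zero => simp
      | succ m ih =>
        rw [pow_succ', Module.End.mul_apply, ih, H.sg_comm q hq,
          show (m + 1) * q = q + m * q by ring, pow_add T q, Module.End.mul_apply]
    rw [Polynomial.aeval_monomial, Polynomial.expand_monomial, Polynomial.aeval_monomial,
      Module.End.mul_apply, h1, Module.algebraMap_end_apply, Module.End.mul_apply,
      Module.algebraMap_end_apply, map_smul]

/-- eigenvalues in the rational function field -/
def IsG (a : Fin n → kˣ) (c : AlgebraicClosure k) : Prop :=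
  ∃ γ : k, c = algebraMap k (AlgebraicClosure k) γ ∧ ∃ y : RF k n, y ≠ 0 ∧ tors a y = γ • y

theorem IsG.one (a : Fin n → kˣ) : IsG a 1 := ⟨1, by simp, 1, one_ne_zero, by simp⟩

theorem IsG.mul {c c' : AlgebraicClosure k} (h : IsG a c) (h' : IsG a c') : IsG a (c * c') := by
  obtain ⟨γ, rfl, y, hy, e⟩ := h
  obtain ⟨γ', rfl, y', hy', e'⟩ := h'
  refine ⟨γ * γ', by simp, y * y', mul_ne_zero hy hy', ?_⟩
  rw [map_mul, e, e', smul_mul_smul_comm]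

theorem IsG.ne_zero {c : AlgebraicClosure k} (h : IsG a c) : c ≠ 0 := by
  obtain ⟨γ, rfl, y, hy, e⟩ := h
  rintro h0
  have : γ = 0 := by simpa using h0
  rw [this, zero_smul] at e
  exact hy ((map_eq_zero (tors a)).1 e)

theorem IsG.inv {c : AlgebraicClosure k} (h : IsG a c) : IsG a c⁻¹ := by
  have h0 := h.ne_zero
  obtain ⟨γ, rfl, y, hy, e⟩ := h
  refine ⟨γ⁻¹, by simp, y⁻¹, inv_ne_zero hy, ?_⟩
  rw [map_inv₀, e, smul_inv₀]

theorem IsG.pow {c : AlgebraicClosure k} (h : IsG a c) (m : ℕ) : IsG a (c ^ m) := by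
  induction m with
  | zero => rw [pow_zero]; exact IsG.one a
  | succ m ih => rw [pow_succ]; exact ih.mul h

theorem isG_chi (a : Fin n → kˣ) (α : Fin n →₀ ℕ) :
    IsG a (algebraMap k (AlgebraicClosure k) (chi a α)) := by
  refine ⟨_, rfl, emb (monomial α 1), emb_ne_zero (by simp), ?_⟩
  rw [tors_monomial, Algebra.smul_def]

end sys

end

end TorusCocycle

namespace TorusCocycle

open MvPolynomial

noncomputable section

variable {k : Type} [Field k] {n N : ℕ} {a : Fin n → kˣ} {T : Module.End k (Fin N → RF k n)}
    {sg : ℕ → Module.End k (Fin N → RF k n)}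

theorem Sys.minpoly_smul (H : Sys a T sg) {γ : k} {y : RF k n} (hy : tors a y = γ • y)
    {c : AlgebraicClosure k} {v : Fin N → RF k n} (hv : Polynomial.aeval T (minpoly k c) v = 0) :
    Polynomial.aeval T (minpoly k (algebraMap k (AlgebraicClosure k) γ * c)) (y • v) = 0 := by
  rw [H.aeval_smul hy, aeval_dvd T _ hv, smul_zero]
  apply minpoly.dvd
  rw [Polynomial.aeval_comp]
  simp [minpoly.aeval]

theorem Sys.minpoly_sg (H : Sys a T sg) (q : ℕ) (hq : 0 < q)
    {c : AlgebraicClosure k} {v : Fin N → RF k n} (hv : Polynomial.aeval T (minpoly k c) v = 0) :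
    Polynomial.aeval T (minpoly k (c ^ q)) (sg q v) = 0 := by
  rw [H.aeval_sg q hq, aeval_dvd T _ hv, map_zero]
  apply minpoly.dvd
  rw [Polynomial.expand_aeval, minpoly.aeval]

/-- pigeonhole for roots -/
theorem root_pigeon (γ : k) (b : AlgebraicClosure k) (m : ℕ)
    (h : Polynomial.aeval (algebraMap k (AlgebraicClosure k) γ * b ^ m) (minpoly k b) = 0) :
    ∃ s t : ℕ, s < t ∧ (fun c => algebraMap k (AlgebraicClosure k) γ * c ^ m)^[s] b =
      (fun c => algebraMap k (AlgebraicClosure k) γ * c ^ m)^[t] b := by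
  have hi : IsIntegral k b := Algebra.IsIntegral.isIntegral b
  set φ : AlgebraicClosure k → AlgebraicClosure k :=
    fun c => algebraMap k (AlgebraicClosure k) γ * c ^ m with hφ
  have hd : minpoly k b ∣ (minpoly k b).comp (Polynomial.C γ * Polynomial.X ^ m) := by
    apply minpoly.dvd
    rw [Polynomial.aeval_comp]
    simpa using h
  have hroot : ∀ c, Polynomial.aeval c (minpoly k b) = 0 →
      Polynomial.aeval (φ c) (minpoly k b) = 0 := by
    intro c hc
    obtain ⟨r, hr⟩ := hd
    have := congrArg (Polynomial.aeval c) hr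
    rw [Polynomial.aeval_comp, map_mul (Polynomial.aeval c) (minpoly k b) r, hc, zero_mul] at this
    simpa [hφ] using this
  have hmem : ∀ t, φ^[t] b ∈ (minpoly k b).rootSet (AlgebraicClosure k) := by
    intro t
    rw [Polynomial.mem_rootSet_of_ne (minpoly.ne_zero hi)]
    induction t with
    | zero => exact minpoly.aeval k b
    | succ t ih => rw [Function.iterate_succ_apply']; exact hroot _ ih
  have hfin : ((minpoly k b).rootSet (AlgebraicClosure k)).Finite := Polynomial.rootSet_finite _ _
  obtain ⟨s, -, t, -, hne, he⟩ := Set.infinite_univ.exists_ne_map_eq_of_mapsTo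
    (f := fun t : ℕ => φ^[t] b) (fun t _ => hmem t) hfin
  rcases lt_or_gt_of_ne hne with h | h
  · exact ⟨s, t, h, he⟩
  · exact ⟨t, s, h, he.symm⟩

theorem iter_one (γ b : AlgebraicClosure k) (t : ℕ) :
    (fun c => γ * c ^ 1)^[t] b = γ ^ t * b := by
  induction t with
  | zero => simp
  | succ t ih => rw [Function.iterate_succ_apply', ih, pow_one]; ring

theorem iter_isG {γ : AlgebraicClosure k} (hγ : IsG a γ) (b : AlgebraicClosure k) (m t : ℕ) :
    ∃ δ, IsG a δ ∧ (fun c => γ * c ^ m)^[t] b = δ * b ^ (m ^ t) := by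
  induction t with
  | zero => exact ⟨1, IsG.one a, by simp⟩
  | succ t ih =>
    obtain ⟨δ, hδ, e⟩ := ih
    refine ⟨γ * δ ^ m, hγ.mul (hδ.pow m), ?_⟩
    rw [Function.iterate_succ_apply', e, mul_pow, ← pow_mul, pow_succ, mul_assoc]

theorem expand_monomials (g : MvPolynomial (Fin n) k) (s : Finset (Fin n →₀ ℕ))
    (hs : g.support ⊆ s) (v : Fin N → RF k n) :
    (emb g : RF k n) • v = ∑ α ∈ s, (emb (monomial α (1 : k)) : RF k n) • (coeff α g • v) := by
  classical
  conv_lhs => rw [g.as_sum, Finset.sum_subset (f := fun α => monomial α (coeff α g)) hs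
    (fun α _ h => by rw [notMem_support_iff.1 h, monomial_zero])]
  rw [map_sum, Finset.sum_smul]
  refine Finset.sum_congr rfl fun α _ => ?_
  rw [smul_comm, ← smul_assoc, ← map_smul, smul_monomial, smul_eq_mul, mul_one]

theorem exists_rel {ι : Type} [Fintype ι] (v : ι → (Fin N → RF k n))
    (hv : ¬ LinearIndependent (RF k n) v) :
    ∃ g : ι → MvPolynomial (Fin n) k, ∑ i, (emb (g i) : RF k n) • v i = 0 ∧ ∃ i, g i ≠ 0 := by
  rw [← LinearIndependent.iff_fractionRing (R := MvPolynomial (Fin n) k)] at hv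
  rw [Fintype.not_linearIndependent_iff] at hv
  obtain ⟨g, hg, i, hi⟩ := hv
  refine ⟨g, ?_, i, hi⟩
  rw [← hg]
  refine Finset.sum_congr rfl fun i _ => ?_
  rw [emb_eq, algebraMap_smul]

theorem Sys.claim (H : Sys a T sg) (ha : Generic a) {v : Fin N → RF k n} (hv0 : v ≠ 0)
    (c : AlgebraicClosure k) (hv : Polynomial.aeval T (minpoly k c) v = 0) :
    ∃ e : ℕ, 0 < e ∧ IsG a (c ^ e) := by
  classical
  have hc0 : c ≠ 0 := by
    rintro rfl
    rw [minpoly.zero, Polynomial.aeval_X] at hv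
    exact hv0 (H.T_inj (by rw [hv, map_zero]))
  have hnli : ¬ LinearIndependent (RF k n) (fun i : Fin (N + 1) => sg (2 ^ (i : ℕ)) v) := by
    intro h
    have := h.fintype_card_le_finrank
    simp at this
  obtain ⟨g, hg, i0, hi0⟩ := exists_rel _ hnli
  obtain ⟨α0, hα0⟩ := ne_zero_iff.1 hi0
  set s : Finset (Fin n →₀ ℕ) := Finset.univ.biUnion fun i => (g i).support with hs
  set χ : (Fin n →₀ ℕ) → AlgebraicClosure k := fun α => algebraMap k _ (chi a α) with hχ
  have hχ0 : ∀ α, χ α ≠ 0 := fun α => (isG_chi a α).ne_zero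
  have hsum : ∑ x ∈ (Finset.univ : Finset (Fin (N + 1))) ×ˢ s,
      (emb (monomial x.2 (1 : k)) : RF k n) • (coeff x.2 (g x.1) • sg (2 ^ (x.1 : ℕ)) v) = 0 := by
    rw [Finset.sum_product, ← hg]
    refine Finset.sum_congr rfl fun i _ => ?_
    rw [expand_monomials (g i) s]
    exact Finset.subset_biUnion_of_mem (fun i => (g i).support) (Finset.mem_univ i)
  have hkill : ∀ x : Fin (N + 1) × (Fin n →₀ ℕ), Polynomial.aeval T
      (minpoly k (χ x.2 * c ^ (2 ^ (x.1 : ℕ))))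
      ((emb (monomial x.2 (1 : k)) : RF k n) • (coeff x.2 (g x.1) • sg (2 ^ (x.1 : ℕ)) v)) = 0 := by
    intro x
    rw [smul_comm, map_smul, H.minpoly_smul _ (H.minpoly_sg _ (by positivity) hv), smul_zero]
    rw [tors_monomial, Algebra.smul_def]
  have hex : ∃ x y : Fin (N + 1) × (Fin n →₀ ℕ), x ≠ y ∧
      minpoly k (χ x.2 * c ^ (2 ^ (x.1 : ℕ))) = minpoly k (χ y.2 * c ^ (2 ^ (y.1 : ℕ))) := by
    by_contra! hcon
    have := coprime_indep T _ (fun x : Fin (N + 1) × (Fin n →₀ ℕ) =>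
      minpoly k (χ x.2 * c ^ (2 ^ (x.1 : ℕ)))) _
      (fun x _ y _ hxy => minpoly_coprime _ _ (hcon x y hxy)) (fun x _ => hkill x) hsum
      (i0, α0) (by
        rw [Finset.mem_product]
        exact ⟨Finset.mem_univ _, Finset.mem_biUnion.2
          ⟨i0, Finset.mem_univ _, mem_support_iff.2 hα0⟩⟩)
    simp only [smul_eq_zero] at this
    rcases this with h | h | h
    · exact emb_ne_zero (by simp) h
    · exact hα0 h
    · exact hv0 (H.sg_inj (2 ^ (i0 : ℕ)) (by positivity) (by rw [h, map_zero]))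
  obtain ⟨i, α, i', α', hle, hne, he⟩ : ∃ i α i' α', i ≤ i' ∧ ((i = i') → α ≠ α') ∧
      minpoly k (χ α * c ^ (2 ^ i)) = minpoly k (χ α' * c ^ (2 ^ i')) := by
    obtain ⟨⟨i, α⟩, ⟨i', α'⟩, hne, he⟩ := hex
    rcases le_total (i : ℕ) i' with h | h
    · refine ⟨i, α, i', α', h, ?_, he⟩
      intro h1 h2
      exact hne (by rw [Fin.ext h1, h2])
    · refine ⟨i', α', i, α, h, ?_, he.symm⟩
      intro h1 h2
      exact hne (by rw [Fin.ext h1, h2])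
  obtain ⟨m, hm⟩ : ∃ m, m = 2 ^ (i' - i) := ⟨_, rfl⟩
  set b := χ α * c ^ (2 ^ i) with hb
  have hb0 : b ≠ 0 := mul_ne_zero (hχ0 _) (pow_ne_zero _ hc0)
  have hbm : algebraMap k (AlgebraicClosure k) (chi a α' / chi a α ^ m) * b ^ m =
      χ α' * c ^ (2 ^ i') := by
    rw [map_div₀, map_pow, hb, mul_pow, ← pow_mul, hm, ← pow_add, show i + (i' - i) = i' by omega]
    have := hχ0 α
    simp only [hχ] at this ⊢
    field_simp
  obtain ⟨s', t, hst, hit⟩ := root_pigeon (chi a α' / chi a α ^ m) b m (by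
    rw [hbm, he, minpoly.aeval])
  have hγ : IsG a (algebraMap k (AlgebraicClosure k) (chi a α' / chi a α ^ m)) := by
    rw [map_div₀, map_pow, div_eq_mul_inv]
    exact (isG_chi a α').mul ((isG_chi a α).pow m).inv
  rcases Nat.eq_or_lt_of_le hle with hii | hii
  · exfalso
    have hm1 : m = 1 := by rw [hm, hii]; simp
    rw [hm1] at hit hγ
    rw [iter_one, iter_one] at hit
    have h2 := mul_right_cancel₀ hb0 hit
    have h3 : algebraMap k (AlgebraicClosure k) (chi a α' / chi a α ^ 1) ^ (t - s') = 1 := by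
      have : t = s' + (t - s') := by omega
      rw [this, pow_add] at h2
      exact (mul_eq_left₀ (pow_ne_zero _ hγ.ne_zero)).1 h2.symm
    rw [← map_pow, map_eq_one_iff _ (algebraMap k (AlgebraicClosure k)).injective, pow_one,
      div_pow, div_eq_one_iff_eq (pow_ne_zero _ (chi_ne_zero _ _))] at h3
    exact hne hii (ha _ (by omega) _ _ h3).symm
  · have hm2 : 2 ≤ m := by
      rw [hm]
      calc 2 = 2 ^ 1 := rfl
        _ ≤ _ := Nat.pow_le_pow_right two_pos (by omega)
    obtain ⟨δ, hδ, e1⟩ := iter_isG hγ b m s'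
    obtain ⟨δ', hδ', e2⟩ := iter_isG hγ b m t
    rw [e1, e2] at hit
    have hlt : m ^ s' < m ^ t := Nat.pow_lt_pow_right (by omega) hst
    have hE : IsG a (b ^ (m ^ t - m ^ s')) := by
      have : b ^ (m ^ t - m ^ s') = δ * δ'⁻¹ := by
        rw [show m ^ t = m ^ s' + (m ^ t - m ^ s') by omega, pow_add] at hit
        have := hδ'.ne_zero
        have hbb : b ^ (m ^ s') ≠ 0 := pow_ne_zero _ hb0
        field_simp
        apply mul_left_cancel₀ hbb
        rw [mul_comm _ δ, hit]
        ring
      rw [this]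
      exact hδ.mul hδ'.inv
    refine ⟨2 ^ i * (m ^ t - m ^ s'), Nat.mul_pos (by positivity) (by omega), ?_⟩
    have : c ^ (2 ^ i * (m ^ t - m ^ s')) = b ^ (m ^ t - m ^ s') * (χ α ^ (m ^ t - m ^ s'))⁻¹ := by
      rw [hb, mul_pow, pow_mul]
      have := pow_ne_zero (m ^ t - m ^ s') (hχ0 α)
      field_simp
    rw [this]
    exact hE.mul ((isG_chi a α).pow _).inv

end

end TorusCocycle

namespace TorusCocycle

open MvPolynomial

noncomputable section

variable {k : Type} [Field k] {n N : ℕ} {a : Fin n → kˣ} {T : Module.End k (Fin N → RF k n)}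
    {sg : ℕ → Module.End k (Fin N → RF k n)}

theorem mem_W (v : Fin N → RF k n) : v ∈ T.maxGenEigenspace 1 ↔
    ∃ r : ℕ, Polynomial.aeval T ((Polynomial.X - 1 : Polynomial k) ^ r) v = 0 := by
  rw [Module.End.mem_maxGenEigenspace]
  simp

theorem Sys.smul_mem_W (H : Sys a T sg) {γ : k} (hγ : γ ≠ 0) {y : RF k n}
    (hy : tors a y = γ • y) (r : ℕ) {v : Fin N → RF k n}
    (hv : Polynomial.aeval T ((Polynomial.X - Polynomial.C γ) ^ r) v = 0) :
    y⁻¹ • v ∈ T.maxGenEigenspace 1 := by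
  rw [mem_W]
  refine ⟨r, ?_⟩
  have hy' : tors a y⁻¹ = γ⁻¹ • y⁻¹ := by rw [map_inv₀, hy, smul_inv₀]
  rw [H.aeval_smul hy', aeval_dvd T _ hv, smul_zero]
  rw [Polynomial.pow_comp]
  apply pow_dvd_pow_of_dvd
  refine ⟨Polynomial.C γ⁻¹, ?_⟩
  rw [Polynomial.sub_comp, Polynomial.X_comp, Polynomial.one_comp, sub_mul, ← Polynomial.C_mul,
    mul_inv_cancel₀ hγ, Polynomial.C_1, mul_comm]

theorem Sys.W_smul (H : Sys a T sg) (α : Fin n →₀ ℕ) {v : Fin N → RF k n} (r : ℕ)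
    (hv : Polynomial.aeval T ((Polynomial.X - 1 : Polynomial k) ^ r) v = 0) :
    Polynomial.aeval T ((Polynomial.X - Polynomial.C (chi a α)) ^ r)
      ((emb (monomial α (1 : k)) : RF k n) • v) = 0 := by
  have hy : tors a (emb (monomial α (1 : k))) = chi a α • emb (monomial α (1 : k)) := by
    rw [tors_monomial, Algebra.smul_def]
  rw [H.aeval_smul hy, aeval_dvd T _ hv, smul_zero]
  rw [Polynomial.pow_comp]
  apply pow_dvd_pow_of_dvd
  refine ⟨Polynomial.C (chi a α), ?_⟩
  rw [Polynomial.sub_comp, Polynomial.X_comp, Polynomial.C_comp]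
  ring

theorem Sys.W_spans (H : Sys a T sg) (ha : Generic a) (u : Fin N → (Fin N → RF k n))
    (hu : LinearIndependent (RF k n) u)
    (hann : ∀ i, ∃ p : Polynomial k, p ≠ 0 ∧ Polynomial.aeval T p (u i) = 0) :
    Submodule.span (RF k n) (T.maxGenEigenspace 1 : Set (Fin N → RF k n)) = ⊤ := by
  classical
  choose p hp hpu hmin using fun i => exists_min_annih T (u i) (hann i)
  have hroot : ∀ i, ∀ c ∈ ((p i).aroots (AlgebraicClosure k)).toFinset,
      ∃ e : ℕ, 0 < e ∧ IsG a (c ^ e) := by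
    intro i c hc
    rw [Multiset.mem_toFinset, Polynomial.mem_aroots] at hc
    obtain ⟨v, hv0, hv⟩ := exists_eigen T (u i) (p i) (hp i) (hpu i) (hmin i) c hc.2
    exact H.claim ha hv0 c hv
  set Z : Finset (AlgebraicClosure k) :=
    Finset.univ.biUnion fun i => ((p i).aroots (AlgebraicClosure k)).toFinset with hZ
  obtain ⟨e, he0, he⟩ : ∃ e : ℕ, 0 < e ∧ ∀ c ∈ Z, IsG a (c ^ e) := by
    have h1 : ∀ c ∈ Z, ∃ e : ℕ, 0 < e ∧ IsG a (c ^ e) := by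
      intro c hc
      obtain ⟨i, -, hi⟩ := Finset.mem_biUnion.1 hc
      exact hroot i c hi
    clear_value Z
    clear hZ
    induction Z using Finset.induction_on with
    | empty => exact ⟨1, one_pos, by simp⟩
    | insert c Z hc ih =>
      obtain ⟨e, he, h2⟩ := ih fun c' hc' => h1 c' (Finset.mem_insert_of_mem hc')
      obtain ⟨e', he', h2'⟩ := h1 c (Finset.mem_insert_self _ _)
      refine ⟨e * e', Nat.mul_pos he he', fun c' hc' => ?_⟩
      rcases Finset.mem_insert.1 hc' with rfl | h
      · rw [mul_comm, pow_mul]; exact h2'.pow e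
      · rw [pow_mul]; exact (h2 c' h).pow e'
  choose! γ hγ y hy0 hy using he
  have hγ0 : ∀ c ∈ Z, γ c ≠ 0 := by
    intro c hc h0
    have := hy c hc
    rw [h0, zero_smul] at this
    exact hy0 c hc ((map_eq_zero (tors a)).1 this)
  set F : Submodule (RF k n) (Fin N → RF k n) :=
    Submodule.span (RF k n) (T.maxGenEigenspace 1 : Set (Fin N → RF k n)) with hF
  have hw : ∀ i, sg e (u i) ∈ F := by
    intro i
    set S : Finset k := (((p i).aroots (AlgebraicClosure k)).toFinset).image γ with hS
    have h1 : Polynomial.aeval T (∏ x ∈ S, (Polynomial.X - Polynomial.C x) ^ (p i).natDegree)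
        (sg e (u i)) = 0 := by
      rw [H.aeval_sg e he0, aeval_dvd T _ (hpu i), map_zero]
      rw [Finset.prod_pow, map_pow, ← Polynomial.map_dvd_map' (algebraMap k (AlgebraicClosure k)),
        Polynomial.map_pow,
        ← Polynomial.natDegree_map (algebraMap k (AlgebraicClosure k)) (p := p i)]
      apply dvd_pow_of_roots
      · exact (Polynomial.map_ne_zero_iff (algebraMap k (AlgebraicClosure k)).injective).2 (hp i)
      · intro c hc
        have hcm : c ∈ ((p i).aroots (AlgebraicClosure k)).toFinset := by
          rw [Multiset.mem_toFinset, Polynomial.mem_aroots]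
          refine ⟨hp i, ?_⟩
          rw [Polynomial.IsRoot.def, Polynomial.eval_map_algebraMap] at hc
          exact hc
        have hcZ : c ∈ Z := Finset.mem_biUnion.2 ⟨i, Finset.mem_univ _, hcm⟩
        rw [Polynomial.IsRoot.def, Polynomial.eval_map_algebraMap, Polynomial.expand_aeval, map_prod]
        apply Finset.prod_eq_zero (Finset.mem_image_of_mem γ hcm)
        rw [map_sub, Polynomial.aeval_X, Polynomial.aeval_C, hγ c hcZ, sub_self]
    have h2 := ker_prod_le T S (fun x => (Polynomial.X - Polynomial.C x) ^ (p i).natDegree)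
      (fun x _ x' _ hne => (Polynomial.isCoprime_X_sub_C_of_isUnit_sub
        (isUnit_iff_ne_zero.2 (sub_ne_zero.2 hne))).pow) (F.restrictScalars k) ?_
    · exact h2 h1
    · intro x hx v hv
      obtain ⟨c, hc, rfl⟩ := Finset.mem_image.1 hx
      have hcZ : c ∈ Z := Finset.mem_biUnion.2 ⟨i, Finset.mem_univ _, hc⟩
      have h3 := H.smul_mem_W (hγ0 c hcZ) (hy c hcZ) _ (LinearMap.mem_ker.1 hv)
      have h4 := F.smul_mem (y c) (Submodule.subset_span h3)
      rw [smul_smul, mul_inv_cancel₀ (hy0 c hcZ), one_smul] at h4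
      exact h4
  have hli := H.sg_li e he0 u hu
  have hsp := hli.span_eq_top_of_card_eq_finrank' (by simp)
  rw [eq_top_iff, ← hsp, Submodule.span_le]
  rintro _ ⟨i, rfl⟩
  exact hw i

theorem Sys.W_li (H : Sys a T sg) (ha : Generic a) {ι : Type} [Fintype ι]
    (w : ι → (Fin N → RF k n)) (hw : ∀ i, w i ∈ T.maxGenEigenspace 1)
    (hli : LinearIndependent k w) : LinearIndependent (RF k n) w := by
  classical
  by_contra hcon
  obtain ⟨g, hg, i0, hi0⟩ := exists_rel _ hcon
  obtain ⟨α0, hα0⟩ := ne_zero_iff.1 hi0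
  set s : Finset (Fin n →₀ ℕ) := Finset.univ.biUnion fun i => (g i).support with hs
  have hsum : ∑ α ∈ s, (emb (monomial α (1 : k)) : RF k n) • (∑ i, coeff α (g i) • w i) = 0 := by
    rw [← hg]
    simp_rw [Finset.smul_sum]
    rw [Finset.sum_comm]
    refine Finset.sum_congr rfl fun i _ => ?_
    rw [expand_monomials (g i) s]
    exact Finset.subset_biUnion_of_mem (fun i => (g i).support) (Finset.mem_univ i)
  have hmem : ∀ α, ∃ r : ℕ, Polynomial.aeval T ((Polynomial.X - 1 : Polynomial k) ^ r)
      (∑ i, coeff α (g i) • w i) = 0 := by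
    intro α
    rw [← mem_W]
    exact Submodule.sum_mem _ fun i _ => Submodule.smul_mem _ _ (hw i)
  choose r hr using hmem
  have := coprime_indep T s (fun α => (Polynomial.X - Polynomial.C (chi a α)) ^ (r α)) _
    (fun α _ β _ hne => (Polynomial.isCoprime_X_sub_C_of_isUnit_sub
        (isUnit_iff_ne_zero.2 (sub_ne_zero.2 fun h => hne (ha 1 one_pos _ _ (by rw [h]))))).pow)
    (fun α _ => H.W_smul α (r α) (hr α)) hsum α0
    (Finset.mem_biUnion.2 ⟨i0, Finset.mem_univ _, mem_support_iff.2 hα0⟩)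
  rw [smul_eq_zero] at this
  rcases this with h | h
  · exact emb_ne_zero (by simp) h
  · exact hα0 (Fintype.linearIndependent_iff.1 hli _ h i0)

theorem Sys.W_finite (H : Sys a T sg) (ha : Generic a) :
    Module.Finite k (T.maxGenEigenspace 1) := by
  classical
  rw [← Module.rank_lt_aleph0_iff]
  refine lt_of_le_of_lt (rank_le (n := N) fun s hs => ?_) (Cardinal.natCast_lt_aleph0)
  have h1 := hs.map' (T.maxGenEigenspace 1).subtype (Submodule.ker_subtype _)
  have h2 := H.W_li ha (fun i : s => ((i : T.maxGenEigenspace 1) : Fin N → RF k n)) (fun i => (i : T.maxGenEigenspace 1).2) h1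
  have := h2.fintype_card_le_finrank
  simpa using this

theorem Sys.sg_surj (H : Sys a T sg) (ha : Generic a) (q : ℕ) (hq : 0 < q)
    (w : Fin N → RF k n) (hw : w ∈ T.maxGenEigenspace 1) : ∃ v, sg q v = w := by
  have hst : ∀ v ∈ T.maxGenEigenspace 1, sg q v ∈ T.maxGenEigenspace 1 := by
    intro v hv
    rw [mem_W] at hv ⊢
    obtain ⟨r, hr⟩ := hv
    refine ⟨r, ?_⟩
    rw [H.aeval_sg q hq, aeval_dvd T _ hr, map_zero]
    rw [map_pow, map_sub, Polynomial.expand_X, map_one]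
    exact pow_dvd_pow_of_dvd (sub_one_dvd_pow_sub_one _ _) _
  have := H.W_finite ha
  have hinj : Function.Injective ((sg q).restrict hst) := by
    intro x y hxy
    exact Subtype.ext (H.sg_inj q hq (congrArg Subtype.val hxy))
  obtain ⟨v, hv⟩ := LinearMap.injective_iff_surjective.1 hinj ⟨w, hw⟩
  exact ⟨v, congrArg Subtype.val hv⟩

end

end TorusCocycle

namespace TorusCocycle

open MvPolynomial

noncomputable section

variable {k : Type} [Field k] {n N : ℕ}

theorem exists_generic [CharZero k] : ∃ a : Fin n → kˣ, Generic a := by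
  classical
  let P : Fin n → ℕ := fun j => Nat.nth Nat.Prime j
  have hP : ∀ j, (P j).Prime := fun j => Nat.prime_nth_prime j
  have hPi : Function.Injective P := fun i j h =>
    Fin.ext (Nat.nth_injective Nat.infinite_setOfPred_prime h)
  refine ⟨fun j => Units.mk0 (P j : k) (Nat.cast_ne_zero.2 (hP j).ne_zero), ?_⟩
  intro s hs α β h
  have hchi : ∀ α : Fin n →₀ ℕ, chi (fun j => Units.mk0 (P j : k)
      (Nat.cast_ne_zero.2 (hP j).ne_zero)) α = ((∏ j, P j ^ α j : ℕ) : k) := by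
    intro α
    simp [chi]
  rw [hchi, hchi, ← Nat.cast_pow, ← Nat.cast_pow, Nat.cast_inj] at h
  have h1 := Nat.pow_left_injective (by omega : s ≠ 0) h
  have hfac : ∀ α : Fin n →₀ ℕ, ∀ i, (∏ j, P j ^ α j).factorization (P i) = α i := by
    intro α i
    rw [Nat.factorization_prod (fun j _ => pow_ne_zero _ (hP j).ne_zero), Finsupp.finsetSum_apply,
      Finset.sum_eq_single i]
    · rw [Nat.factorization_pow, Finsupp.smul_apply, (hP i).factorization_self]; simp
    · intro j _ hj
      rw [Nat.factorization_pow, Finsupp.smul_apply, (hP j).factorization, Finsupp.single_apply,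
        if_neg (fun h => hj (hPi h))]
      simp
    · simp
  ext i
  rw [← hfac α i, ← hfac β i]
  exact congrArg (fun m => Nat.factorization m (P i)) h1

theorem emb_expand (g : MvPolynomial (Fin n) k) (s : Finset (Fin n →₀ ℕ))
    (hs : g.support ⊆ s) :
    (emb g : RF k n) = ∑ α ∈ s, algebraMap k (RF k n) (coeff α g) * emb (monomial α (1 : k)) := by
  classical
  conv_lhs => rw [g.as_sum, Finset.sum_subset (f := fun α => monomial α (coeff α g)) hs
    (fun α _ h => by rw [notMem_support_iff.1 h, monomial_zero])]
  rw [map_sum]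
  refine Finset.sum_congr rfl fun α _ => ?_
  rw [← Algebra.smul_def, ← map_smul, smul_monomial, smul_eq_mul, mul_one]

theorem fixed_const (ℓ : ℕ) (hℓ : 2 ≤ ℓ) (hroots : ∀ m : ℕ, ∃ ζ : k, IsPrimitiveRoot ζ (ℓ ^ m))
    (u : RF k n) (hu : ∀ m : ℕ, ∀ ζ : Fin n → kˣ, ζ ^ (ℓ ^ m) = 1 → tors ζ u = u) :
    ∃ c : k, u = algebraMap k (RF k n) c := by
  classical
  obtain ⟨P, Q, hQ, hPQ⟩ := exists_frac u
  set s := Q.support ∪ P.support with hs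
  obtain ⟨B, hB⟩ : ∃ B : ℕ, ∀ α ∈ s, ∀ j, α j < ℓ ^ B := by
    refine ⟨∑ α ∈ s, ∑ j, α j, fun α hα j => ?_⟩
    refine lt_of_le_of_lt ?_ (Nat.lt_pow_self (by omega))
    refine le_trans ?_ (Finset.single_le_sum (f := fun α : Fin n →₀ ℕ => ∑ j, α j)
      (fun _ _ => Nat.zero_le _) hα)
    exact Finset.single_le_sum (f := fun j => α j) (fun _ _ => Nat.zero_le _) (Finset.mem_univ j)
  obtain ⟨z, hz⟩ := hroots B
  have hz0 : z ≠ 0 := hz.ne_zero (by positivity)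
  let G : Subgroup (Fin n → kˣ) := (powMonoidHom (ℓ ^ B) : (Fin n → kˣ) →* (Fin n → kˣ)).ker
  let χ : (Fin n →₀ ℕ) → (G →* RF k n) := fun α =>
    { toFun := fun ζ => algebraMap k (RF k n) (chi (ζ : Fin n → kˣ) α)
      map_one' := by simp [chi_one]
      map_mul' := fun x y => by simp [chi_mul] }
  have hχ : ∀ α ζ, χ α ζ = algebraMap k (RF k n) (chi (ζ : Fin n → kˣ) α) := fun _ _ => rfl
  have hinj : Function.Injective (fun α : s => χ α) := by
    intro α β h
    apply Subtype.ext
    ext j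
    have hmem : Pi.mulSingle j (Units.mk0 z hz0) ∈ G := by
      change (Pi.mulSingle j (Units.mk0 z hz0) : Fin n → kˣ) ^ (ℓ ^ B) = 1
      rw [← Pi.mulSingle_pow]
      have : (Units.mk0 z hz0) ^ (ℓ ^ B) = 1 := by
        ext; simp [hz.pow_eq_one]
      rw [this, Pi.mulSingle_one]
    have h1 := DFunLike.congr_fun h ⟨_, hmem⟩
    simp only [hχ] at h1
    have h2 := (algebraMap k (RF k n)).injective h1
    have h3 : ∀ α : Fin n →₀ ℕ, chi (Pi.mulSingle j (Units.mk0 z hz0)) α = z ^ α j := by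
      intro α
      rw [chi, Finset.prod_eq_single j]
      · simp
      · intro i _ hi
        rw [Pi.mulSingle_eq_of_ne hi]; simp
      · simp
    rw [h3, h3] at h2
    exact hz.pow_inj (hB _ α.2 j) (hB _ β.2 j) h2
  have hli := (linearIndependent_monoidHom G (RF k n)).comp _ hinj
  rw [Fintype.linearIndependent_iff] at hli
  have hzero := hli (fun α => (algebraMap k (RF k n) (coeff α Q) * u -
    algebraMap k (RF k n) (coeff α P)) * emb (monomial (α : Fin n →₀ ℕ) (1 : k))) (by
      ext ζ
      have h1 := congrArg (tors (ζ : Fin n → kˣ)) hPQ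
      rw [map_mul, hu B _ ζ.2, tors_emb, tors_emb, emb_expand _ s, emb_expand (scal _ P) s,
        ← sub_eq_zero, Finset.sum_mul, ← Finset.sum_sub_distrib, ← Finset.sum_coe_sort] at h1
      · rw [Finset.sum_apply, Pi.zero_apply]
        refine Eq.trans (Finset.sum_congr rfl fun α _ => ?_) h1
        simp only [Pi.smul_apply, Function.comp, smul_eq_mul, hχ, coeff_scal, map_mul]
        ring
      · rw [support_scal]; exact Finset.subset_union_right
      · rw [support_scal]; exact Finset.subset_union_left)
  obtain ⟨α, hα⟩ := ne_zero_iff.1 hQ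
  have h2 := hzero ⟨α, Finset.mem_union_left _ (mem_support_iff.2 hα)⟩
  rw [mul_eq_zero, or_iff_left (emb_ne_zero (by simp)), sub_eq_zero] at h2
  refine ⟨coeff α P / coeff α Q, ?_⟩
  rw [map_div₀, eq_div_iff (by simpa using hα), mul_comm]
  exact h2

/-- semilinear operator attached to a matrix -/
def Top (M : Matrix (Fin N) (Fin N) (RF k n)) (s : RF k n →ₐ[k] RF k n) :
    Module.End k (Fin N → RF k n) :=
  (M.mulVecLin.restrictScalars k) ∘ₗ (s.toLinearMap.compLeft (Fin N))

theorem Top_apply (M : Matrix (Fin N) (Fin N) (RF k n)) (s : RF k n →ₐ[k] RF k n)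
    (v : Fin N → RF k n) : Top M s v = M.mulVec (fun i => s (v i)) := rfl

theorem Top_mul (M M' : Matrix (Fin N) (Fin N) (RF k n)) (s t : RF k n →ₐ[k] RF k n)
    (v : Fin N → RF k n) : Top M s (Top M' t v) = Top (M * M'.map s) (s * t) v := by
  rw [Top_apply, Top_apply, Top_apply, ← Matrix.mulVec_mulVec]
  congr 1
  ext i
  exact RingHom.map_mulVec s.toRingHom M' _ i

theorem Top_smul (M : Matrix (Fin N) (Fin N) (RF k n)) (s : RF k n →ₐ[k] RF k n) (y : RF k n)
    (v : Fin N → RF k n) : Top M s (y • v) = s y • Top M s v := by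
  rw [Top_apply, Top_apply, ← Matrix.mulVec_smul]
  congr 1
  ext i
  simp

theorem Top_one (v : Fin N → RF k n) : Top 1 1 v = v := by
  rw [Top_apply, Matrix.one_mulVec]
  rfl

theorem isUnit_map {M : Matrix (Fin N) (Fin N) (RF k n)} (hM : IsUnit M)
    (s : RF k n →ₐ[k] RF k n) : IsUnit (M.map s) :=
  hM.map (RingHom.mapMatrix s.toRingHom)

theorem Top_inj {M : Matrix (Fin N) (Fin N) (RF k n)} (hM : IsUnit M)
    (s : RF k n →ₐ[k] RF k n) : Function.Injective (Top M s) := by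
  intro v w h
  have h1 := Matrix.mulVec_injective_of_isUnit hM h
  ext i
  exact s.toRingHom.injective (congrFun h1 i)

theorem Top_li {M : Matrix (Fin N) (Fin N) (RF k n)} (hM : IsUnit M)
    (s : RF k n →ₐ[k] RF k n) (u : Fin N → (Fin N → RF k n))
    (hu : LinearIndependent (RF k n) u) : LinearIndependent (RF k n) (fun i => Top M s (u i)) := by
  have h1 : IsUnit (Matrix.of u) := Matrix.linearIndependent_rows_iff_isUnit.1 hu
  have h2 : IsUnit ((Matrix.of u).map s * M.transpose) :=
    (isUnit_map h1 s).mul ((Matrix.isUnit_transpose M).2 hM)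
  have h3 := Matrix.linearIndependent_rows_iff_isUnit.2 h2
  have h4 : (fun i => Top M s (u i)) = ((Matrix.of u).map s * M.transpose).row := by
   ext i j
   rw [Top_apply]
   simp only [Matrix.row, Matrix.mul_apply, Matrix.mulVec, dotProduct, Matrix.transpose_apply,
     Matrix.map_apply, Matrix.of_apply]
   exact Finset.sum_congr rfl fun l _ => mul_comm _ _
  rw [h4]
  exact h3

theorem map_hom_mul (s : RF k n →ₐ[k] RF k n) (A B : Matrix (Fin N) (Fin N) (RF k n)) :
    (A * B).map s = A.map s * B.map s := Matrix.map_mul (f := s.toRingHom)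

theorem map_hom_one (s : RF k n →ₐ[k] RF k n) :
    (1 : Matrix (Fin N) (Fin N) (RF k n)).map s = 1 := by
  apply Matrix.map_one <;> simp

theorem exists_basis_in (S : Set (Fin N → RF k n)) (hS : Submodule.span (RF k n) S = ⊤) :
    ∃ w : Fin N → (Fin N → RF k n), (∀ i, w i ∈ S) ∧ LinearIndependent (RF k n) w := by
  obtain ⟨b, hbS, hbs, hbl⟩ := exists_linearIndependent (RF k n) S
  rw [hS] at hbs
  let B := Module.Basis.mk hbl (by rw [Subtype.range_coe, hbs])
  let e := (Pi.basisFun (RF k n) (Fin N)).indexEquiv B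
  exact ⟨fun i => (e i : Fin N → RF k n), fun i => hbS (e i).2, hbl.comp _ e.injective⟩

end

end TorusCocycle

namespace TorusCocycle

open MvPolynomial

noncomputable section

variable {k : Type} [Field k] {n N : ℕ}

/-- the monoid of the statement -/
def InS (s : RF k n →ₐ[k] RF k n) : Prop :=
  ∃ (lam : Fin n → kˣ) (q : Fin n → ℤ), (∀ j, q j ≠ 0) ∧
    ∀ j : Fin n, s (emb (X j)) = algebraMap k (RF k n) (lam j) * (emb (X j)) ^ (q j)

theorem inS_tors (a : Fin n → kˣ) : InS (tors a) :=
  ⟨a, fun _ => 1, fun _ => one_ne_zero, fun j => by rw [tors_X, zpow_one]⟩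

theorem inS_frob (q : ℕ) (hq : 0 < q) : InS (frob q hq : RF k n →ₐ[k] RF k n) :=
  ⟨1, fun _ => q, fun _ => by simpa using hq.ne', fun j => by
    rw [frob_X, zpow_natCast]; simp⟩

theorem tors_comm {s : RF k n →ₐ[k] RF k n} (hs : InS s) (m : ℕ) (ζ : Fin n → kˣ)
    (hζ : ζ ^ m = 1) : ∃ ζ' : Fin n → kˣ, ζ' ^ m = 1 ∧ tors ζ * s = s * tors ζ' := by
  obtain ⟨lam, q, -, h⟩ := hs
  refine ⟨fun j => ζ j ^ q j, ?_, ?_⟩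
  · funext j
    have := congrFun hζ j
    simp only [Pi.pow_apply, Pi.one_apply] at this ⊢
    rw [← zpow_natCast, ← zpow_mul, mul_comm, zpow_mul, zpow_natCast, this, one_zpow]
  · apply hom_ext
    intro j
    rw [AlgHom.mul_apply, AlgHom.mul_apply, h, tors_X, map_mul, map_mul, map_zpow₀, tors_X,
      AlgHom.commutes, AlgHom.commutes, h, mul_zpow]
    simp only [Units.val_zpow_eq_zpow_val, map_zpow₀]
    ring

theorem tors_frob_one (m : ℕ) (hm : 0 < m) (ζ : Fin n → kˣ) (hζ : ζ ^ m = 1) :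
    tors ζ * frob m hm = frob m hm := by
  rw [tors_frob, hζ, tors_one, mul_one]

theorem exists_trivialization [CharZero k]
    (ℓ : ℕ) (hℓ : 2 ≤ ℓ)
    (f : (RF k n →ₐ[k] RF k n) → Matrix (Fin N) (Fin N) (RF k n))
    (hf : ∀ s, InS s → IsUnit (f s))
    (hmul : ∀ s, InS s → ∀ t, InS t → f (s * t) = f s * (f t).map ⇑s) :
    ∃ g : Matrix (Fin N) (Fin N) (RF k n), IsUnit g ∧
      ∀ m : ℕ, ∀ ζ : Fin n → kˣ, ζ ^ (ℓ ^ m) = 1 → f (tors ζ) * g.map (tors ζ) = g := by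
  classical
  obtain ⟨a, ha⟩ := exists_generic (k := k) (n := n)
  have hf1 : f 1 = 1 := by
    have hS1 : InS (1 : RF k n →ₐ[k] RF k n) := by rw [← tors_one]; exact inS_tors _
    have h1 := hmul 1 hS1 1 hS1
    rw [mul_one] at h1
    have h2 : (f 1).map (1 : RF k n →ₐ[k] RF k n) = f 1 := by ext i j; rfl
    rw [h2] at h1
    exact ((hf 1 hS1).mul_eq_left).1 h1.symm
  have hu : ∀ j, IsUnit (f (tors (a ^ j))) := fun j => hf _ (inS_tors _)
  have hmi : ∀ j, f (tors (a ^ j)) * (f (tors (a ^ j)))⁻¹ = 1 := fun j =>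
    Matrix.mul_nonsing_inv _ ((Matrix.isUnit_iff_isUnit_det _).1 (hu j))
  have him : ∀ j, (f (tors (a ^ j)))⁻¹ * f (tors (a ^ j)) = 1 := fun j =>
    Matrix.nonsing_inv_mul _ ((Matrix.isUnit_iff_isUnit_det _).1 (hu j))
  have hadd : ∀ i j, f (tors (a ^ (i + j))) = f (tors (a ^ i)) * (f (tors (a ^ j))).map
      (tors (a ^ i)) := by
    intro i j
    rw [pow_add, ← tors_mul]
    exact hmul _ (inS_tors _) _ (inS_tors _)
  have hcoc : Coc a (fun j => f (tors (a ^ j))) (fun j => (f (tors (a ^ j)))⁻¹) :=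
    { zero := by simp only [pow_zero]; rw [tors_one, hf1]
      izero := by simp only [pow_zero]; rw [tors_one, hf1, inv_one]
      add := hadd
      iadd := by
        intro i j
        rw [hadd, Matrix.mul_inv_rev]
        congr 1
        apply Matrix.inv_eq_right_inv
        rw [← map_mul_tors, hmi, map_one_tors]
      mul_inv := hmi
      inv_mul := him }
  set F := f (frob 2 two_pos) with hFdef
  have hFu : IsUnit F := hf _ (inS_frob _ _)
  obtain ⟨D, hD⟩ := bounded_cplx a (fun j => f (tors (a ^ j))) hadd F F⁻¹ (by
    intro j
    have h1 := hmul _ (inS_tors (a ^ j)) _ (inS_frob 2 two_pos)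
    have h2 := hmul _ (inS_frob 2 two_pos) _ (inS_tors (a ^ (2 * j)))
    rw [tors_frob, ← pow_mul, mul_comm j 2, h2] at h1
    rw [Matrix.mul_assoc, ← h1, ← Matrix.mul_assoc,
      Matrix.nonsing_inv_mul _ ((Matrix.isUnit_iff_isUnit_det _).1 hFu), Matrix.one_mul])
  obtain ⟨h, A, hh, hA, D', J, hJ⟩ := fact5 ha hcoc hD
  set T := Top (f (tors a)) (tors a) with hT
  set sg : ℕ → Module.End k (Fin N → RF k n) := fun q =>
    if hq : 0 < q then Top (f (frob q hq)) (frob q hq) else 0 with hsg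
  have hsgq : ∀ q (hq : 0 < q), sg q = Top (f (frob q hq)) (frob q hq) := fun q hq => dif_pos hq
  have hTpow : ∀ (j : ℕ) v, (T ^ j) v = Top (f (tors (a ^ j))) (tors (a ^ j)) v := by
    intro j
    induction j with
    | zero => intro v; rw [pow_zero, pow_zero, tors_one, hf1, Top_one]; rfl
    | succ j ih =>
      intro v
      rw [pow_succ', Module.End.mul_apply, ih, hT, Top_mul, ← hmul _ (inS_tors _) _ (inS_tors _),
        tors_mul, pow_succ']
  have H : Sys a T sg :=
    { T_smul := fun y v => Top_smul _ _ _ _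
      T_inj := Top_inj (hf _ (inS_tors _)) _
      sg_comm := by
        intro q hq v
        rw [hsgq q hq, hTpow, hT, Top_mul, Top_mul, ← hmul _ (inS_tors _) _ (inS_frob _ _),
          ← hmul _ (inS_frob _ _) _ (inS_tors _), tors_frob]
      sg_inj := by
        intro q hq
        rw [hsgq q hq]
        exact Top_inj (hf _ (inS_frob _ _)) _
      sg_li := by
        intro q hq u hu
        rw [hsgq q hq]
        exact Top_li (hf _ (inS_frob _ _)) _ u hu }
  have hspan := H.W_spans ha (fun i => (emb h : RF k n) • (Pi.single i 1 : Fin N → RF k n)) (by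
      have h1 := (Pi.basisFun (RF k n) (Fin N)).linearIndependent
      have h2 := h1.units_smul (fun _ => Units.mk0 (emb h : RF k n) (emb_ne_zero hh))
      convert h2 using 1
      funext i
      rw [Pi.smul_apply', Pi.basisFun_apply, Units.smul_def, Units.val_mk0]) (by
    intro i
    let φ : (Fin N → restrictTotalDegree (Fin n) k D') →ₗ[k] (Fin N → RF k n) :=
      LinearMap.pi fun r => (LinearMap.mulLeft k (emb A : RF k n)⁻¹).comp
        ((emb.toLinearMap.comp (restrictTotalDegree (Fin n) k D').subtype).comp
          (LinearMap.proj r))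
    have hφ : ∀ P r, φ P r = (emb A : RF k n)⁻¹ * emb (P r : MvPolynomial (Fin n) k) :=
      fun _ _ => rfl
    refine exists_annih T _ J (LinearMap.range φ) fun j hj => ?_
    choose P hPd hP using fun r => hJ j hj r i
    refine ⟨fun r => ⟨P r, (mem_restrictTotalDegree _ _ _).2 (hPd r)⟩, ?_⟩
    funext r
    rw [hφ, hTpow, Top_smul, tors_emb, Pi.smul_apply, Top_apply, ← hP, ← mul_assoc,
      inv_mul_cancel₀ (emb_ne_zero hA), one_mul, smul_eq_mul, mul_comm]
    congr 1
    rw [Matrix.mulVec, dotProduct, Finset.sum_eq_single i]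
    · simp
    · intro l _ hl
      rw [Pi.single_eq_of_ne hl]; simp
    · simp)
  obtain ⟨w, hwW, hw⟩ := exists_basis_in _ hspan
  refine ⟨(Matrix.of w).transpose, (Matrix.isUnit_transpose _).2
    (Matrix.linearIndependent_rows_iff_isUnit.1 hw), fun m ζ hζ => ?_⟩
  have hpos : 0 < ℓ ^ m := by positivity
  have hfix : ∀ i, Top (f (tors ζ)) (tors ζ) (w i) = w i := by
    intro i
    obtain ⟨v, hv⟩ := H.sg_surj ha (ℓ ^ m) hpos (w i) (hwW i)
    rw [← hv, hsgq _ hpos, Top_mul, ← hmul _ (inS_tors _) _ (inS_frob _ _),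
      tors_frob_one _ _ _ hζ]
  ext r i
  exact congrFun (hfix i) r

theorem const_matrix (ℓ : ℕ) (hℓ : 2 ≤ ℓ)
    (hroots : ∀ m : ℕ, ∃ ζ : k, IsPrimitiveRoot ζ (ℓ ^ m))
    (B : Matrix (Fin N) (Fin N) (RF k n)) (hBu : IsUnit B)
    (hB : ∀ m : ℕ, ∀ ζ : Fin n → kˣ, ζ ^ (ℓ ^ m) = 1 → B.map (tors ζ) = B) :
    ∃ C : Matrix (Fin N) (Fin N) k, IsUnit C ∧ B = C.map (algebraMap k (RF k n)) := by
  choose C hC using fun i j => fixed_const ℓ hℓ hroots (B i j) (fun m ζ hζ =>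
    congrFun (congrFun (hB m ζ hζ) i) j)
  have hBC : B = (Matrix.of C).map (algebraMap k (RF k n)) := by
    ext i j; exact hC i j
  refine ⟨Matrix.of C, ?_, hBC⟩
  rw [Matrix.isUnit_iff_isUnit_det, isUnit_iff_ne_zero] at hBu ⊢
  intro h0
  apply hBu
  have := (algebraMap k (RF k n)).map_det (Matrix.of C)
  rw [h0, map_zero] at this
  rw [hBC]
  exact this.symm

theorem part_one [CharZero k]
    (ℓ : ℕ) (hℓ : 2 ≤ ℓ) (hroots : ∀ m : ℕ, ∃ ζ : k, IsPrimitiveRoot ζ (ℓ ^ m))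
    (f : (RF k n →ₐ[k] RF k n) → Matrix (Fin N) (Fin N) (RF k n))
    (hf : ∀ s, InS s → IsUnit (f s))
    (hmul : ∀ s, InS s → ∀ t, InS t → f (s * t) = f s * (f t).map ⇑s) :
    ∃ g : Matrix (Fin N) (Fin N) (RF k n), IsUnit g ∧
      ∀ s, InS s → ∃ C : Matrix (Fin N) (Fin N) k, IsUnit C ∧
        f s * g.map ⇑s = g * C.map (algebraMap k (RF k n)) := by
  obtain ⟨g, hg, hfix⟩ := exists_trivialization ℓ hℓ f hf hmul
  refine ⟨g, hg, fun s hs => ?_⟩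
  have hgd := (Matrix.isUnit_iff_isUnit_det _).1 hg
  have hgC : g * (g⁻¹ * (f s * g.map s)) = f s * g.map s := by
    rw [← Matrix.mul_assoc, Matrix.mul_nonsing_inv _ hgd, Matrix.one_mul]
  have hmm : ∀ s t : RF k n →ₐ[k] RF k n, (g.map t).map s = g.map (s * t : RF k n →ₐ[k] RF k n) := by
    intro s t; ext i j; rfl
  obtain ⟨C, hCu, hC⟩ := const_matrix ℓ hℓ hroots (g⁻¹ * (f s * g.map s)) (by
      refine IsUnit.mul ?_ ((hf s hs).mul (isUnit_map hg s))
      exact Matrix.isUnit_nonsing_inv_iff.2 hg) (by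
    intro m ζ hζ
    obtain ⟨ζ', hζ', hc⟩ := tors_comm hs _ ζ hζ
    apply hg.mul_left_cancel
    have h1 : f (tors ζ) * (f s * g.map s).map (tors ζ) = f s * g.map s := by
      rw [map_hom_mul, ← Matrix.mul_assoc, ← hmul _ (inS_tors _) _ hs, hmm, hc,
        hmul _ hs _ (inS_tors _), ← hmm, Matrix.mul_assoc, ← map_hom_mul, hfix m ζ' hζ']
    rw [hgC]
    conv_lhs => rw [← hfix m ζ hζ]
    rw [Matrix.mul_assoc, hfix m ζ hζ, ← map_hom_mul, hgC, h1])
  exact ⟨C, hCu, by rw [← hC, hgC]⟩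

theorem part_two
    (ℓ : ℕ) (hℓ : 2 ≤ ℓ) (hroots : ∀ m : ℕ, ∃ ζ : k, IsPrimitiveRoot ζ (ℓ ^ m))
    (a a' : (RF k n →ₐ[k] RF k n) → Matrix (Fin N) (Fin N) k)
    (ha : ∀ s, InS s → IsUnit (a s)) (ha' : ∀ s, InS s → IsUnit (a' s))
    (hm : ∀ s, InS s → ∀ t, InS t → a (s * t) = a s * a t)
    (hm' : ∀ s, InS s → ∀ t, InS t → a' (s * t) = a' s * a' t)
    (g : Matrix (Fin N) (Fin N) (RF k n)) (hg : IsUnit g)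
    (hag : ∀ s, InS s → g * (a' s).map (algebraMap k (RF k n))
      = (a s).map (algebraMap k (RF k n)) * g.map ⇑s) :
    ∃ C : Matrix (Fin N) (Fin N) k, IsUnit C ∧ ∀ s, InS s → C * a' s = a s * C := by
  have htriv : ∀ b : (RF k n →ₐ[k] RF k n) → Matrix (Fin N) (Fin N) k,
      (∀ s, InS s → IsUnit (b s)) → (∀ s, InS s → ∀ t, InS t → b (s * t) = b s * b t) →
      ∀ m : ℕ, ∀ ζ : Fin n → kˣ, ζ ^ (ℓ ^ m) = 1 → b (tors ζ) = 1 := by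
    intro b hb hbm m ζ hζ
    have hpos : 0 < ℓ ^ m := by positivity
    have h1 := hbm _ (inS_tors ζ) _ (inS_frob _ hpos)
    rw [tors_frob_one _ _ _ hζ] at h1
    exact ((hb _ (inS_frob _ hpos)).mul_eq_right).1 h1.symm
  have hone : (1 : Matrix (Fin N) (Fin N) k).map (algebraMap k (RF k n)) = 1 := by
    apply Matrix.map_one <;> simp
  obtain ⟨C, hCu, hC⟩ := const_matrix ℓ hℓ hroots g hg (by
    intro m ζ hζ
    have h1 := hag _ (inS_tors ζ)
    rw [htriv a ha hm m ζ hζ, htriv a' ha' hm' m ζ hζ, hone, Matrix.mul_one, Matrix.one_mul] at h1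
    exact h1.symm)
  refine ⟨C, hCu, fun s hs => ?_⟩
  have h1 := hag s hs
  have h2 : g.map s = C.map (algebraMap k (RF k n)) := by
    rw [hC]; ext i j; simp
  rw [h2, hC, ← Matrix.map_mul, ← Matrix.map_mul] at h1
  exact Matrix.map_injective (algebraMap k (RF k n)).injective h1

end

end TorusCocycle

/-- **`H¹((ℤ_{≠0} ⋉ kˣ)ⁿ, GL_N(k)) ≅ H¹((ℤ_{≠0} ⋉ kˣ)ⁿ, GL_N(k(x₁,…,xₙ)))`.**
Let `k` be a field of characteristic zero containing all `ℓ`-power roots of unity for some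
`ℓ ≥ 2`, and let `S` be the monoid of `k`-algebra endomorphisms of `k(x₁,…,xₙ)` of the form
`xⱼ ↦ λⱼ·xⱼ^{qⱼ}` (`λⱼ ∈ kˣ`, `qⱼ ∈ ℤ∖{0}`).  Then:
(i) every `1`-cocycle of `S` with values in `GL_N(k(x₁,…,xₙ))` is cohomologous to a cocycle
with constant values in `GL_N(k)`;
(ii) two multiplicative maps `S → GL_N(k)` cohomologous over `k(x₁,…,xₙ)` are conjugate by
an element of `GL_N(k)`. -/
theorem torus_semigroup_cocycles_constant
    (k : Type) [Field k] [CharZero k] (n N : ℕ) (hn : 1 ≤ n) (hN : 1 ≤ N)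
    (ℓ : ℕ) (hℓ : 2 ≤ ℓ) (hroots : ∀ m : ℕ, ∃ ζ : k, IsPrimitiveRoot ζ (ℓ ^ m))
    (Sset : Set (FractionRing (MvPolynomial (Fin n) k) →ₐ[k] FractionRing (MvPolynomial (Fin n) k)))
    (hSdef : Sset = {σ | ∃ (lam : Fin n → kˣ) (q : Fin n → ℤ), (∀ j, q j ≠ 0) ∧
      ∀ j : Fin n,
        σ (algebraMap (MvPolynomial (Fin n) k) (FractionRing (MvPolynomial (Fin n) k))
            (MvPolynomial.X j))
          = algebraMap k (FractionRing (MvPolynomial (Fin n) k)) (lam j) *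
            (algebraMap (MvPolynomial (Fin n) k) (FractionRing (MvPolynomial (Fin n) k))
              (MvPolynomial.X j)) ^ (q j)}) :
    (∀ f : (FractionRing (MvPolynomial (Fin n) k) →ₐ[k] FractionRing (MvPolynomial (Fin n) k)) →
        Matrix (Fin N) (Fin N) (FractionRing (MvPolynomial (Fin n) k)),
      (∀ σ ∈ Sset, IsUnit (f σ)) →
      (∀ σ ∈ Sset, ∀ τ ∈ Sset, f (σ * τ) = f σ * (f τ).map ⇑σ) →
      ∃ g : Matrix (Fin N) (Fin N) (FractionRing (MvPolynomial (Fin n) k)), IsUnit g ∧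
        ∀ σ ∈ Sset, ∃ C : Matrix (Fin N) (Fin N) k, IsUnit C ∧
          f σ * g.map ⇑σ = g * C.map (algebraMap k (FractionRing (MvPolynomial (Fin n) k)))) ∧
    (∀ a a' : (FractionRing (MvPolynomial (Fin n) k) →ₐ[k] FractionRing (MvPolynomial (Fin n) k)) →
        Matrix (Fin N) (Fin N) k,
      (∀ σ ∈ Sset, IsUnit (a σ)) → (∀ σ ∈ Sset, IsUnit (a' σ)) →
      (∀ σ ∈ Sset, ∀ τ ∈ Sset, a (σ * τ) = a σ * a τ) →
      (∀ σ ∈ Sset, ∀ τ ∈ Sset, a' (σ * τ) = a' σ * a' τ) →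
      ∀ g : Matrix (Fin N) (Fin N) (FractionRing (MvPolynomial (Fin n) k)), IsUnit g →
        (∀ σ ∈ Sset, g * (a' σ).map (algebraMap k (FractionRing (MvPolynomial (Fin n) k)))
            = (a σ).map (algebraMap k (FractionRing (MvPolynomial (Fin n) k))) * g.map ⇑σ) →
        ∃ C : Matrix (Fin N) (Fin N) k, IsUnit C ∧ ∀ σ ∈ Sset, C * a' σ = a σ * C) := by
  subst hSdef
  refine ⟨fun f hf hmul => ?_, fun a a' ha ha' hm hm' g hg hag => ?_⟩
  · exact TorusCocycle.part_one ℓ hℓ hroots f hf hmul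
  · exact TorusCocycle.part_two ℓ hℓ hroots a a' ha ha' hm hm' g hg hag
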